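/- arXiv:1606.09444 — 3 statements merged into one kernel-verified Lean document; each statement's English description precedes it below -/
import Mathlib

section
/- Let B ⊆ GL_n(L) be a bounded subset, i.e. there is N ∈ ℕ such that every g ∈ B satisfies ε^N·g ∈ M_n(O) and ε^N·g^{-1} ∈ M_n(O). Then there exists c ∈ ℕ such that for every d ∈ ℕ, every g ∈ B and every h ∈ K_{d+c} there exists l ∈ K_d with g·h = l^{-1}·g·σ(l). -/
open scoped MatrixGroups

/-- The variable `ε` of the field of Laurent series `L = k((ε))`. -/
noncomputable def eps (k : Type*) [Field k] : LaurentSeries k := HahnSeries.single (1 : ℤ) 1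

/-- A Laurent series lies in the ring of integers `O = k[[ε]]`. -/
def InO {k : Type*} [Field k] (x : LaurentSeries k) : Prop :=
  ∀ m : ℤ, m < 0 → x.coeff m = 0

/-- Membership in `K = GL_n(O)`: both `g` and `g⁻¹` have entries in `O`. -/
def MemK {k : Type*} [Field k] {n : ℕ} (g : GL (Fin n) (LaurentSeries k)) : Prop :=
  (∀ i j, InO ((g : Matrix (Fin n) (Fin n) (LaurentSeries k)) i j)) ∧
  (∀ i j, InO (((g⁻¹ : GL (Fin n) (LaurentSeries k)) :
      Matrix (Fin n) (Fin n) (LaurentSeries k)) i j))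

/-- Membership in the principal congruence subgroup
`K_m = {g ∈ GL_n(O) : g ≡ 1 mod ε^m}`. -/
def MemKm {k : Type*} [Field k] {n : ℕ} (m : ℕ) (g : GL (Fin n) (LaurentSeries k)) : Prop :=
  MemK g ∧ ∀ i j, ∀ s : ℤ, s < (m : ℤ) →
    (((g : Matrix (Fin n) (Fin n) (LaurentSeries k)) - 1) i j).coeff s = 0

/-- `x` lies in `ε^s O`. -/
def Ge0 {k : Type*} [Field k] (s : ℤ) (x : LaurentSeries k) : Prop :=
  ∀ m : ℤ, m < s → x.coeff m = 0

section helpers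
variable {k : Type*} [Field k]

lemma ge0_mul {s t : ℤ} {x y : LaurentSeries k} (hx : Ge0 s x) (hy : Ge0 t y) :
    Ge0 (s + t) (x * y) := by
  intro m hm
  rw [HahnSeries.coeff_mul]
  refine Finset.sum_eq_zero ?_
  rintro ⟨i, j⟩ hij
  rw [Finset.mem_addAntidiagonal] at hij
  obtain ⟨_, _, h3⟩ := hij
  simp only at h3 ⊢
  by_cases hi : i < s
  · rw [hx i hi, zero_mul]
  · rw [hy j (by omega), mul_zero]

lemma ge0_zero (s : ℤ) : Ge0 s (0 : LaurentSeries k) := fun _ _ => rfl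

lemma ge0_add {s : ℤ} {x y : LaurentSeries k} (hx : Ge0 s x) (hy : Ge0 s y) :
    Ge0 s (x + y) := by
  intro m hm
  rw [HahnSeries.coeff_add, hx m hm, hy m hm, add_zero]

lemma ge0_neg {s : ℤ} {x : LaurentSeries k} (hx : Ge0 s x) : Ge0 s (-x) := by
  intro m hm
  rw [HahnSeries.coeff_neg, hx m hm, neg_zero]

lemma ge0_sum {ι : Type*} {s : ℤ} (S : Finset ι) (f : ι → LaurentSeries k)
    (h : ∀ i ∈ S, Ge0 s (f i)) : Ge0 s (∑ i ∈ S, f i) := by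
  classical
  induction S using Finset.induction_on with
  | empty => simpa using ge0_zero s
  | insert a S ha ih =>
    rw [Finset.sum_insert ha]
    exact ge0_add (h a (Finset.mem_insert_self _ _))
      (ih fun i hi => h i (Finset.mem_insert_of_mem hi))

lemma ge0_mono {s t : ℤ} (hst : s ≤ t) {x : LaurentSeries k} (hx : Ge0 t x) : Ge0 s x :=
  fun m hm => hx m (by omega)

lemma ge0_one : Ge0 0 (1 : LaurentSeries k) := by
  intro m hm
  rw [HahnSeries.coeff_one, if_neg (by omega)]

/-- Entrywise version for matrices. -/
def MGe {n : ℕ} (s : ℤ) (X : Matrix (Fin n) (Fin n) (LaurentSeries k)) : Prop :=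
  ∀ i j, Ge0 s (X i j)

lemma mge_mul {n : ℕ} {s t : ℤ} {X Y : Matrix (Fin n) (Fin n) (LaurentSeries k)}
    (hX : MGe s X) (hY : MGe t Y) : MGe (s + t) (X * Y) := by
  intro i j
  rw [Matrix.mul_apply]
  exact ge0_sum _ _ fun l _ => ge0_mul (hX i l) (hY l j)

lemma ge0_ps (f : PowerSeries k) : Ge0 0 (HahnSeries.ofPowerSeries ℤ k f) := by
  intro m hm
  rw [HahnSeries.ofPowerSeries_apply]
  apply HahnSeries.embDomain_notin_range
  rintro ⟨a, ha⟩
  simp at ha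
  omega

lemma coeff_ps (f : PowerSeries k) (m : ℕ) :
    (HahnSeries.ofPowerSeries ℤ k f).coeff (m : ℤ) = PowerSeries.coeff m f :=
  HahnSeries.ofPowerSeries_apply_coeff f m

lemma exists_ps {x : LaurentSeries k} (hx : Ge0 0 x) :
    HahnSeries.ofPowerSeries ℤ k (PowerSeries.mk fun m : ℕ => x.coeff (m : ℤ)) = x := by
  ext m
  by_cases hm : m < 0
  · rw [hx m hm, ge0_ps _ m hm]
  · obtain ⟨a, rfl⟩ := Int.eq_ofNat_of_zero_le (not_lt.mp hm)
    rw [coeff_ps, PowerSeries.coeff_mk]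

lemma ge0_of_eps {N : ℕ} {x : LaurentSeries k} (h : InO (eps k ^ N * x)) :
    Ge0 (-(N : ℤ)) x := by
  intro m hm
  have h1 := h (m + N) (by omega)
  rw [eps, HahnSeries.single_pow, one_pow] at h1
  have h2 : (m + (N : ℤ)) = m + N • (1 : ℤ) := by simp
  rw [h2, HahnSeries.coeff_single_mul_add] at h1
  simpa using h1

/-- Solving one additive polynomial over an algebraically closed field. -/
lemma solve_one [IsAlgClosed k] (q : ℕ) (hq : 2 ≤ q) (r : ℕ) (c : ℕ → k) (i0 : ℕ)
    (hi0 : i0 < r + 1) (hc : c i0 ≠ 0) (w : k) :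
    ∃ z : k, ∑ i ∈ Finset.range (r + 1), c i * z ^ q ^ (r - i) = w := by
  classical
  let P : Polynomial k := (∑ i ∈ Finset.range (r + 1),
    Polynomial.C (c i) * Polynomial.X ^ q ^ (r - i)) - Polynomial.C w
  have hco : P.coeff (q ^ (r - i0)) = c i0 := by
    simp only [P, Polynomial.coeff_sub, Polynomial.finset_sum_coeff,
      Polynomial.coeff_C_mul_X_pow, Polynomial.coeff_C]
    rw [if_neg (by positivity), sub_zero, Finset.sum_eq_single i0]
    · simp
    · intro b hb hne
      rw [Finset.mem_range] at hb
      rw [if_neg]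
      intro h
      have := Nat.pow_right_injective hq h
      omega
    · intro h
      exact absurd (Finset.mem_range.mpr hi0) h
  have hdeg : P.degree ≠ 0 := by
    intro h0
    have h1 : P.coeff (q ^ (r - i0)) = 0 := by
      apply Polynomial.coeff_eq_zero_of_degree_lt
      rw [h0]
      have : 0 < q ^ (r - i0) := by positivity
      exact_mod_cast this
    exact hc (hco ▸ h1)
  obtain ⟨z, hz⟩ := IsAlgClosed.exists_root P hdeg
  refine ⟨z, ?_⟩
  rw [Polynomial.IsRoot.def] at hz
  simp only [P, Polynomial.eval_sub, Polynomial.eval_finset_sum, Polynomial.eval_mul,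
    Polynomial.eval_C, Polynomial.eval_pow, Polynomial.eval_X] at hz
  exact sub_eq_zero.mp hz

/-- Coefficients of the solution, constructed recursively. -/
noncomputable def solSeq (sol : k → k) (q r : ℕ) (c : ℕ → PowerSeries k) (t : PowerSeries k)
    (s : ℕ) : k :=
  sol (PowerSeries.coeff s t - ∑ i ∈ Finset.range (r + 1), ∑ b : Fin s,
    PowerSeries.coeff (s - b) (c i) * (solSeq sol q r c t b) ^ q ^ (r - i))
termination_by s
decreasing_by exact b.2

lemma solve_ps [IsAlgClosed k] (q : ℕ) (hq : 2 ≤ q) (r : ℕ) (c : ℕ → PowerSeries k) (i0 : ℕ)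
    (hi0 : i0 < r + 1) (hc : PowerSeries.coeff 0 (c i0) ≠ 0) (t : PowerSeries k) :
    ∃ z : ℕ → k, ∑ i ∈ Finset.range (r + 1),
      (PowerSeries.mk fun m => z m ^ q ^ (r - i)) * c i = t := by
  choose sol hsol using solve_one q hq r (fun i => PowerSeries.coeff 0 (c i)) i0 hi0 hc
  refine ⟨solSeq sol q r c t, ?_⟩
  ext s
  rw [map_sum]
  have key := hsol (PowerSeries.coeff s t - ∑ i ∈ Finset.range (r + 1), ∑ b : Fin s,
    PowerSeries.coeff (s - b) (c i) * (solSeq sol q r c t b) ^ q ^ (r - i))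
  rw [← solSeq.eq_1 sol q r c t s, eq_sub_iff_add_eq, ← Finset.sum_add_distrib] at key
  rw [← key]
  refine Finset.sum_congr rfl fun i _ => ?_
  rw [PowerSeries.coeff_mul, Finset.Nat.sum_antidiagonal_eq_sum_range_succ_mk,
    Finset.sum_range_succ, add_comm]
  simp only [PowerSeries.coeff_mk, Nat.sub_self]
  rw [mul_comm, Finset.sum_range]
  congr 1
  exact Finset.sum_congr rfl fun b _ => mul_comm _ _

lemma iter_coeff (q : ℕ) (σL : LaurentSeries k →+* LaurentSeries k)
    (hσL : ∀ (x : LaurentSeries k) (m : ℤ), (σL x).coeff m = x.coeff m ^ q) (j : ℕ)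
    (x : LaurentSeries k) (m : ℤ) : (σL^[j] x).coeff m = x.coeff m ^ q ^ j := by
  induction j with
  | zero => simp
  | succ j ih => rw [Function.iterate_succ_apply', hσL, ih, ← pow_mul, pow_succ]

lemma ge0_sigma {q : ℕ} (hq : 2 ≤ q) {σL : LaurentSeries k →+* LaurentSeries k}
    (hσL : ∀ (x : LaurentSeries k) (m : ℤ), (σL x).coeff m = x.coeff m ^ q)
    {s : ℤ} {x : LaurentSeries k} (hx : Ge0 s x) : Ge0 s (σL x) := by
  intro m hm
  rw [hσL, hx m hm, zero_pow (by omega)]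

/-- The twisted additive equation over `O`. -/
lemma solve_laurent [IsAlgClosed k] (q : ℕ) (hq : 2 ≤ q)
    (σL : LaurentSeries k →+* LaurentSeries k)
    (hσL : ∀ (x : LaurentSeries k) (m : ℤ), (σL x).coeff m = x.coeff m ^ q)
    (r : ℕ) (a : ℕ → LaurentSeries k) (ha : ∀ i, Ge0 0 (a i)) (i0 : ℕ)
    (hi0 : i0 < r + 1) (h0 : (a i0).coeff 0 ≠ 0) :
    ∃ z : LaurentSeries k, Ge0 0 z ∧
      1 + ∑ i ∈ Finset.range (r + 1), σL^[r - i] (z * a i) = 0 := by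
  have hit : ∀ j x, Ge0 0 x → Ge0 0 (σL^[j] x) := by
    intro j x hx m hm
    rw [iter_coeff q σL hσL, hx m hm, zero_pow (by positivity)]
  obtain ⟨z, hz⟩ := solve_ps q hq r
    (fun i => PowerSeries.mk fun m : ℕ => (σL^[r - i] (a i)).coeff (m : ℤ)) i0 hi0
    (by
      rw [PowerSeries.coeff_mk, iter_coeff q σL hσL]
      exact pow_ne_zero _ h0) (-1)
  refine ⟨HahnSeries.ofPowerSeries ℤ k (PowerSeries.mk z), ge0_ps _, ?_⟩
  have hz' := congrArg (HahnSeries.ofPowerSeries ℤ k) hz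
  rw [map_sum, map_neg, map_one] at hz'
  rw [← neg_eq_iff_add_eq_zero, ← hz']
  refine Finset.sum_congr rfl fun i _ => ?_
  rw [map_mul, exists_ps (hit _ _ (ha i)), iterate_map_mul]
  congr 1
  rw [← exists_ps (hit (r - i) _ (ge0_ps (PowerSeries.mk z)))]
  congr 1
  ext m
  simp only [PowerSeries.coeff_mk]
  rw [iter_coeff q σL hσL, coeff_ps, PowerSeries.coeff_mk]

/-- A normalized linear relation. -/
lemma exists_rel {V : Type*} [AddCommGroup V] [Module (LaurentSeries k) V]
    [FiniteDimensional (LaurentSeries k) V] (v : ℕ → V) (r : ℕ)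
    (hr : Module.finrank (LaurentSeries k) V = r) :
    ∃ a : ℕ → LaurentSeries k, (∀ i, Ge0 0 (a i)) ∧
      (∃ i0, i0 < r + 1 ∧ (a i0).coeff 0 ≠ 0) ∧
      ∑ i ∈ Finset.range (r + 1), a i • v i = 0 := by
  have hnl : ¬ LinearIndependent (LaurentSeries k) (fun i : Fin (r + 1) => v i) := by
    intro h
    have := h.fintype_card_le_finrank
    rw [hr, Fintype.card_fin] at this
    omega
  rw [Fintype.not_linearIndependent_iff] at hnl
  obtain ⟨b, hb, i1, hi1⟩ := hnl
  obtain ⟨i0, -, hmin⟩ := Finset.exists_min_image Finset.univ (fun i => (b i).orderTop)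
    ⟨i1, Finset.mem_univ _⟩
  have hbi0 : b i0 ≠ 0 := by
    intro h
    have h2 := hmin i1 (Finset.mem_univ _)
    rw [h, HahnSeries.orderTop_zero, top_le_iff, HahnSeries.orderTop_eq_top] at h2
    exact hi1 h2
  set o : ℤ := (b i0).order with ho
  have hoT : (o : WithTop ℤ) = (b i0).orderTop := HahnSeries.order_eq_orderTop_of_ne_zero hbi0
  let a' : Fin (r + 1) → LaurentSeries k := fun i => HahnSeries.single (-o) (1 : k) * b i
  have hco : ∀ i m, (a' i).coeff m = (b i).coeff (m + o) := by
    intro i m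
    have : m = (m + o) + (-o) := by ring
    conv_lhs => rw [this]
    simp only [a']
    rw [HahnSeries.coeff_single_mul_add, one_mul]
  refine ⟨fun i => if h : i < r + 1 then a' ⟨i, h⟩ else 0, ?_, ⟨i0, i0.2, ?_⟩, ?_⟩
  · intro i
    dsimp only
    split_ifs with h
    · intro m hm
      rw [hco]
      apply HahnSeries.coeff_eq_zero_of_lt_orderTop
      refine lt_of_lt_of_le ?_ (hmin _ (Finset.mem_univ _))
      rw [← hoT]
      exact_mod_cast (by omega : m + o < o)
    · exact ge0_zero 0
  · simp only [i0.2, dif_pos]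
    rw [hco, zero_add]
    exact fun h => hbi0 (HahnSeries.coeff_order_eq_zero.mp h)
  · rw [Finset.sum_range]
    simp only [Fin.is_lt, dif_pos, a', mul_smul]
    rw [← Finset.smul_sum, hb, smul_zero]

/-- Partial sums `y_i` . -/
noncomputable def ySeq (σL : LaurentSeries k →+* LaurentSeries k) (z : LaurentSeries k)
    (a : ℕ → LaurentSeries k) : ℕ → LaurentSeries k
  | 0 => 1 + z * a 0
  | s + 1 => σL (ySeq σL z a s) + z * a (s + 1)

lemma ySeq_eq (σL : LaurentSeries k →+* LaurentSeries k) (z : LaurentSeries k)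
    (a : ℕ → LaurentSeries k) (s : ℕ) :
    ySeq σL z a s = 1 + ∑ i ∈ Finset.range (s + 1), σL^[s - i] (z * a i) := by
  induction s with
  | zero => simp [ySeq]
  | succ s ih =>
    rw [ySeq, ih, Finset.sum_range_succ _ (s + 1), map_add, map_one, map_sum, Nat.sub_self,
      Function.iterate_zero, id, add_assoc]
    congr 2
    refine Finset.sum_congr rfl fun i hi => ?_
    rw [Finset.mem_range] at hi
    rw [← Function.iterate_succ_apply' σL, Nat.succ_eq_add_one]
    congr 2
    omega

lemma ySeq_ge {q : ℕ} (hq : 2 ≤ q) {σL : LaurentSeries k →+* LaurentSeries k}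
    (hσL : ∀ (x : LaurentSeries k) (m : ℤ), (σL x).coeff m = x.coeff m ^ q)
    {z : LaurentSeries k} (hz : Ge0 0 z)
    {a : ℕ → LaurentSeries k} (ha : ∀ i, Ge0 0 (a i)) (s : ℕ) :
    Ge0 0 (ySeq σL z a s) := by
  have h : ∀ i, Ge0 0 (z * a i) := fun i => by simpa using ge0_mul hz (ha i)
  induction s with
  | zero => exact ge0_add ge0_one (h 0)
  | succ s ih => exact ge0_add (ge0_sigma hq hσL ih) (h _)

/-- The affine equation `X = Φ X + β` for a semilinear `Φ`: a solution in the span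
of the `Φ^i β`, with integral coefficients. -/
lemma solve_semilinear [IsAlgClosed k] (q : ℕ) (hq : 2 ≤ q)
    (σL : LaurentSeries k →+* LaurentSeries k)
    (hσL : ∀ (x : LaurentSeries k) (m : ℤ), (σL x).coeff m = x.coeff m ^ q)
    {V : Type*} [AddCommGroup V] [Module (LaurentSeries k) V]
    [FiniteDimensional (LaurentSeries k) V] (r : ℕ)
    (hr : Module.finrank (LaurentSeries k) V = r) (Φ : V →ₛₗ[σL] V) (β : V) :
    ∃ y : ℕ → LaurentSeries k, (∀ i, Ge0 0 (y i)) ∧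
      ∑ i ∈ Finset.range r, y i • Φ^[i] β =
        Φ (∑ i ∈ Finset.range r, y i • Φ^[i] β) + β := by
  obtain ⟨a, ha, ⟨i0, hi0, h0⟩, hrel⟩ := exists_rel (fun i => Φ^[i] β) r hr
  obtain ⟨z, hz, hzero⟩ := solve_laurent q hq σL hσL r a ha i0 hi0 h0
  refine ⟨ySeq σL z a, ySeq_ge hq hσL hz ha, ?_⟩
  have key : ∀ s, ∑ i ∈ Finset.range s, ySeq σL z a i • Φ^[i] β
      - Φ (∑ i ∈ Finset.range s, ySeq σL z a i • Φ^[i] β) + ySeq σL z a s • Φ^[s] β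
      = β + z • ∑ i ∈ Finset.range (s + 1), a i • Φ^[i] β := by
    intro s
    induction s with
    | zero => simp [ySeq, add_smul, mul_smul]
    | succ s ih =>
      rw [Finset.sum_range_succ _ (s + 1), smul_add, ← add_assoc, ← ih,
        Finset.sum_range_succ _ s, map_add, LinearMap.map_smulₛₗ, ySeq, add_smul,
        mul_smul, Function.iterate_succ_apply']
      abel
  have hk := key r
  rw [hrel, ySeq_eq, hzero, zero_smul, smul_zero, add_zero, add_zero, sub_eq_iff_eq_add] at hk
  rw [add_comm]
  exact hk

/-- `1 + X` lies in `GL_n(O)` for `X ≡ 0 mod ε`. -/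
lemma exists_unit {n : ℕ} (X : Matrix (Fin n) (Fin n) (LaurentSeries k)) (hX : MGe 1 X) :
    ∃ l : GL (Fin n) (LaurentSeries k),
      (l : Matrix (Fin n) (Fin n) (LaurentSeries k)) = 1 + X ∧ MemK l := by
  let Y : Matrix (Fin n) (Fin n) (PowerSeries k) :=
    fun i j => PowerSeries.mk fun m : ℕ => (X i j).coeff (m : ℤ)
  have hY : (HahnSeries.ofPowerSeries ℤ k).mapMatrix Y = X := by
    ext1 i j
    exact exists_ps (ge0_mono (by norm_num) (hX i j))
  have hY0 : (PowerSeries.constantCoeff (R := k)).mapMatrix Y = 0 := by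
    ext1 i j
    change PowerSeries.constantCoeff (Y i j) = 0
    rw [← PowerSeries.coeff_zero_eq_constantCoeff_apply]
    simp only [Y, PowerSeries.coeff_mk]
    exact hX i j _ (by norm_num)
  have hdet : IsUnit (1 + Y).det := by
    rw [PowerSeries.isUnit_iff_constantCoeff, RingHom.map_det, map_add, hY0, map_one, add_zero,
      Matrix.det_one]
    exact isUnit_one
  obtain ⟨u, hu⟩ := (Matrix.isUnit_iff_isUnit_det _).mpr hdet
  refine ⟨Units.map (RingHom.mapMatrix (HahnSeries.ofPowerSeries ℤ k)).toMonoidHom u, ?_, ?_, ?_⟩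
  · change (HahnSeries.ofPowerSeries ℤ k).mapMatrix (u : Matrix (Fin n) (Fin n) (PowerSeries k)) = _
    rw [hu, map_add, map_one, hY]
  · intro i j
    exact ge0_ps _
  · intro i j
    rw [← map_inv]
    exact ge0_ps _

end helpers

/-- Proposition 2.3 for `G = GL_n`: for a bounded subset `B ⊆ GL_n(L)` there is a `c ∈ ℕ`
such that for each `d ∈ ℕ`, `g ∈ B` and `h ∈ K_{d+c}` there is `l ∈ K_d` with
`g·h = l⁻¹·g·σ(l)`. -/
theorem statement0 (p r q : ℕ) [Fact p.Prime] (hr : 0 < r) (hq : q = p ^ r)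
    (k : Type*) [Field k] [Algebra (GaloisField p r) k] [IsAlgClosure (GaloisField p r) k]
    (n : ℕ)
    (σL : LaurentSeries k →+* LaurentSeries k)
    (hσL : ∀ (x : LaurentSeries k) (m : ℤ), (σL x).coeff m = x.coeff m ^ q)
    (B : Set (GL (Fin n) (LaurentSeries k)))
    (hB : ∃ N : ℕ, ∀ g ∈ B, ∀ i j,
      InO (eps k ^ N * (g : Matrix (Fin n) (Fin n) (LaurentSeries k)) i j) ∧
      InO (eps k ^ N * ((g⁻¹ : GL (Fin n) (LaurentSeries k)) :
        Matrix (Fin n) (Fin n) (LaurentSeries k)) i j)) :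
    ∃ c : ℕ, ∀ d : ℕ, ∀ g ∈ B, ∀ h : GL (Fin n) (LaurentSeries k),
      MemKm (d + c) h →
      ∃ l : GL (Fin n) (LaurentSeries k), MemKm d l ∧
        g * h = l⁻¹ * g * Units.map (RingHom.mapMatrix σL).toMonoidHom l := by
  classical
  have : IsAlgClosed k := IsAlgClosure.isAlgClosed (GaloisField p r)
  have hq2 : 2 ≤ q := by
    rw [hq]
    exact le_trans (Fact.out : p.Prime).two_le (Nat.le_self_pow (by omega) p)
  obtain ⟨N, hN⟩ := hB
  refine ⟨2 * N * (n * n) + 2 * N + 1, fun d g hg h hh => ?_⟩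
  have hg1 : MGe (-(N : ℤ)) (g : Matrix (Fin n) (Fin n) (LaurentSeries k)) :=
    fun i j => ge0_of_eps (hN g hg i j).1
  have hg2 : MGe (-(N : ℤ)) ((g⁻¹ : GL (Fin n) (LaurentSeries k)) :
      Matrix (Fin n) (Fin n) (LaurentSeries k)) :=
    fun i j => ge0_of_eps (hN g hg i j).2
  have hh2 : MGe 0 ((h⁻¹ : GL (Fin n) (LaurentSeries k)) :
      Matrix (Fin n) (Fin n) (LaurentSeries k)) := fun i j => hh.1.2 i j
  have hh1 : MGe ((d + (2 * N * (n * n) + 2 * N + 1) : ℕ) : ℤ)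
      ((h : Matrix (Fin n) (Fin n) (LaurentSeries k)) - 1) := hh.2
  set G : Matrix (Fin n) (Fin n) (LaurentSeries k) := g.1 with hG
  set G' : Matrix (Fin n) (Fin n) (LaurentSeries k) := (g⁻¹).1 with hG'
  set H : Matrix (Fin n) (Fin n) (LaurentSeries k) := h.1 with hH
  set H' : Matrix (Fin n) (Fin n) (LaurentSeries k) := (h⁻¹).1 with hH'
  have e1 : G' * G = 1 := g.inv_mul
  have e2 : G * G' = 1 := g.mul_inv
  have e3 : H' * H = 1 := h.inv_mul
  have e4 : H * H' = 1 := h.mul_inv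
  let Φ : Matrix (Fin n) (Fin n) (LaurentSeries k) →ₛₗ[σL]
      Matrix (Fin n) (Fin n) (LaurentSeries k) :=
    { toFun := fun X => G * σL.mapMatrix X * (H' * G')
      map_add' := fun X Y => by rw [map_add, mul_add, add_mul]
      map_smul' := fun c X => by
        have : σL.mapMatrix (c • X) = σL c • σL.mapMatrix X := by
          ext1 i j
          simp
        rw [this, Matrix.mul_smul, Matrix.smul_mul] }
  have hΦ : ∀ X, Φ X = G * σL.mapMatrix X * (H' * G') := fun _ => rfl
  let β : Matrix (Fin n) (Fin n) (LaurentSeries k) := G * (-(H' * (H - 1))) * G'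
  obtain ⟨y, hy, hX⟩ := solve_semilinear q hq2 σL hσL (n * n)
    (by rw [Module.finrank_matrix]; simp) Φ β
  set X := ∑ i ∈ Finset.range (n * n), y i • Φ^[i] β with hXdef
  have hβ : MGe ((d : ℤ) + 1 + 2 * N * (n * n)) β := by
    have t1 : MGe ((d : ℤ) + (2 * N * (n * n) + 2 * N + 1)) (-(H' * (H - 1))) := by
      intro i j
      rw [Matrix.neg_apply]
      refine ge0_neg (ge0_mono ?_ (mge_mul hh2 hh1 i j))
      push_cast
      omega
    intro i j
    refine ge0_mono ?_ (mge_mul (mge_mul hg1 t1) hg2 i j)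
    linarith
  have hstep : ∀ s Z, MGe s Z → MGe (s - 2 * N) (Φ Z) := by
    intro s Z hZ i j
    have t1 : MGe s (σL.mapMatrix Z) := fun i j => ge0_sigma hq2 hσL (hZ i j)
    rw [hΦ]
    refine ge0_mono ?_ (mge_mul (mge_mul hg1 t1) (mge_mul hh2 hg2) i j)
    linarith
  have hiter : ∀ i : ℕ, MGe ((d : ℤ) + 1 + 2 * N * (n * n) - 2 * N * i) (Φ^[i] β) := by
    intro i
    induction i with
    | zero => simpa using hβ
    | succ i ih =>
      rw [Function.iterate_succ_apply']
      have := hstep _ _ ih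
      have e : ((d : ℤ) + 1 + 2 * N * (n * n) - 2 * N * (i + 1 : ℕ)) =
        (d : ℤ) + 1 + 2 * N * (n * n) - 2 * N * i - 2 * N := by push_cast; ring
      rw [e]
      exact this
  have hXge : MGe ((d : ℤ) + 1) X := by
    intro i j
    rw [hXdef, Matrix.sum_apply]
    refine ge0_sum _ _ fun s hs => ?_
    rw [Finset.mem_range] at hs
    rw [Matrix.smul_apply, smul_eq_mul]
    refine ge0_mono ?_ (ge0_mul (hy s) (hiter s i j))
    have h1 : (s : ℤ) ≤ n * n := by exact_mod_cast hs.le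
    have h2 : 2 * (N : ℤ) * s ≤ 2 * N * (n * n) := by gcongr
    linarith
  obtain ⟨l, hl, hlK⟩ := exists_unit X (fun i j => ge0_mono (by omega) (hXge i j))
  refine ⟨l, ⟨hlK, ?_⟩, ?_⟩
  · intro i j s hs
    rw [hl, add_sub_cancel_left]
    exact hXge i j s (by omega)
  · rw [mul_assoc, eq_inv_mul_iff_mul_eq]
    apply Units.ext
    change l.1 * (G * H) = G * σL.mapMatrix l.1
    rw [hl, map_add, map_one]
    rw [hΦ] at hX
    have hfin : X * (G * H) = G * σL.mapMatrix X - G * (H - 1) := by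
      have c1 : (H' * G') * (G * H) = 1 := by
        rw [mul_assoc, ← mul_assoc G', e1, one_mul, e3]
      have c2 : H' * (H - 1) = 1 - H' := by rw [mul_sub, e3, mul_one]
      have c3 : β * (G * H) = - (G * (H - 1)) := by
        simp only [β]
        rw [c2, mul_assoc, ← mul_assoc G', e1, one_mul, mul_assoc, neg_mul, sub_mul, e3, one_mul,
          mul_neg]
      conv_lhs => rw [hX]
      rw [add_mul, mul_assoc, c1, mul_one, c3, ← sub_eq_add_neg]
    rw [add_mul, hfin, one_mul, mul_add, mul_sub, mul_one]
    abel
end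

section
/- For every b ∈ GL_n(L) there exists m ∈ ℕ such that the central leaf C_b = {g^{-1}·b·σ(g) : g ∈ K} satisfies C_b·K_m = C_b and K_m·C_b = C_b. -/
open scoped MatrixGroups

/-- Membership in `K = GL_n(O)`: both `g` and `g⁻¹` have entries in `O`. -/
def InK {k : Type*} [Field k] {n : ℕ} (g : GL (Fin n) (LaurentSeries k)) : Prop :=
  (∀ i j, InO ((g : Matrix (Fin n) (Fin n) (LaurentSeries k)) i j)) ∧
  (∀ i j, InO (((g⁻¹ : GL (Fin n) (LaurentSeries k)) :
      Matrix (Fin n) (Fin n) (LaurentSeries k)) i j))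

/-- Membership in the principal congruence subgroup
`K_m = {g ∈ GL_n(O) : g ≡ 1 mod ε^m}`. -/
def InKm {k : Type*} [Field k] {n : ℕ} (m : ℕ) (g : GL (Fin n) (LaurentSeries k)) : Prop :=
  InK g ∧ ∀ i j, ∀ s : ℤ, s < (m : ℤ) →
    (((g : Matrix (Fin n) (Fin n) (LaurentSeries k)) - 1) i j).coeff s = 0

section CentralLeaf

variable {k : Type*} [Field k]

/-- `x ∈ ε^c O`. -/
def Bd (c : ℤ) (x : LaurentSeries k) : Prop := ∀ s : ℤ, s < c → x.coeff s = 0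

/-- All entries of `X` lie in `ε^c O`. -/
def MBd {ι κ : Type*} (c : ℤ) (X : Matrix ι κ (LaurentSeries k)) : Prop :=
  ∀ i j, Bd c (X i j)

theorem Bd.mono {c d : ℤ} {x : LaurentSeries k} (h : Bd c x) (hd : d ≤ c) : Bd d x :=
  fun s hs => h s (lt_of_lt_of_le hs hd)

theorem Bd.zero (c : ℤ) : Bd c (0 : LaurentSeries k) := fun _ _ => rfl

theorem Bd.add {c : ℤ} {x y : LaurentSeries k} (hx : Bd c x) (hy : Bd c y) : Bd c (x + y) := by
  intro s hs
  rw [HahnSeries.coeff_add, hx s hs, hy s hs, add_zero]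

theorem Bd.neg {c : ℤ} {x : LaurentSeries k} (hx : Bd c x) : Bd c (-x) := by
  intro s hs
  rw [HahnSeries.coeff_neg, hx s hs, neg_zero]

theorem Bd.sub {c : ℤ} {x y : LaurentSeries k} (hx : Bd c x) (hy : Bd c y) : Bd c (x - y) := by
  rw [sub_eq_add_neg]; exact hx.add hy.neg

theorem Bd.sum {α : Type*} {c : ℤ} (S : Finset α) (f : α → LaurentSeries k)
    (h : ∀ a ∈ S, Bd c (f a)) : Bd c (∑ a ∈ S, f a) := by
  intro s hs
  rw [HahnSeries.coeff_sum]
  exact Finset.sum_eq_zero fun a ha => h a ha s hs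

theorem Bd.mul {c d : ℤ} {x y : LaurentSeries k} (hx : Bd c x) (hy : Bd d y) :
    Bd (c + d) (x * y) := by
  intro s hs
  rw [HahnSeries.coeff_mul]
  refine Finset.sum_eq_zero fun ij hij => ?_
  have h := (Finset.mem_antidiagonal.1 hij).2.2
  by_cases h1 : ij.1 < c
  · rw [hx _ h1, zero_mul]
  · rw [hy _ (by omega), mul_zero]

theorem Bd.exists (x : LaurentSeries k) : ∃ c, Bd c x :=
  ⟨x.order, fun _ hs => HahnSeries.coeff_eq_zero_of_lt_order hs⟩

theorem Bd.one : Bd 0 (1 : LaurentSeries k) := by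
  intro s hs
  rw [HahnSeries.coeff_one, if_neg hs.ne]

theorem Bd.exists_unif {α : Type*} (S : Finset α) (f : α → LaurentSeries k) :
    ∃ c, ∀ a ∈ S, Bd c (f a) := by
  classical
  induction S using Finset.induction_on with
  | empty => exact ⟨0, by simp⟩
  | insert a S _ ih =>
    obtain ⟨c, hc⟩ := ih
    obtain ⟨d, hd⟩ := Bd.exists (f a)
    refine ⟨min c d, fun b hb => ?_⟩
    rcases Finset.mem_insert.1 hb with rfl | hb
    · exact hd.mono (min_le_right _ _)
    · exact (hc b hb).mono (min_le_left _ _)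

theorem Bd.eq_zero {x : LaurentSeries k} (h : ∀ J : ℕ, ∃ c : ℤ, (J : ℤ) ≤ c ∧ Bd c x) :
    x = 0 := by
  ext s
  obtain ⟨c, hc, h⟩ := h (s + 1).toNat
  exact h s (by omega)

section mat
variable {ι κ μ : Type*}

theorem MBd.mono {c d : ℤ} {x : Matrix ι κ (LaurentSeries k)} (h : MBd c x) (hd : d ≤ c) :
    MBd d x := fun i j => (h i j).mono hd

theorem MBd.zero (c : ℤ) : MBd c (0 : Matrix ι κ (LaurentSeries k)) := fun _ _ => Bd.zero c

theorem MBd.add {c : ℤ} {x y : Matrix ι κ (LaurentSeries k)} (hx : MBd c x) (hy : MBd c y) :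
    MBd c (x + y) := fun i j => (hx i j).add (hy i j)

theorem MBd.sub {c : ℤ} {x y : Matrix ι κ (LaurentSeries k)} (hx : MBd c x) (hy : MBd c y) :
    MBd c (x - y) := fun i j => (hx i j).sub (hy i j)

theorem MBd.neg {c : ℤ} {x : Matrix ι κ (LaurentSeries k)} (hx : MBd c x) :
    MBd c (-x) := fun i j => (hx i j).neg

theorem MBd.smul {c d : ℤ} {a : LaurentSeries k} {x : Matrix ι κ (LaurentSeries k)}
    (ha : Bd c a) (hx : MBd d x) : MBd (c + d) (a • x) := fun i j => by
  rw [Matrix.smul_apply, smul_eq_mul]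
  exact ha.mul (hx i j)

theorem MBd.sum {α : Type*} {c : ℤ} (S : Finset α) (f : α → Matrix ι κ (LaurentSeries k))
    (h : ∀ a ∈ S, MBd c (f a)) : MBd c (∑ a ∈ S, f a) := by
  intro i j
  rw [Matrix.sum_apply]
  exact Bd.sum S _ fun a ha => h a ha i j

theorem MBd.mul [Fintype κ] {c d : ℤ} {x : Matrix ι κ (LaurentSeries k)}
    {y : Matrix κ μ (LaurentSeries k)} (hx : MBd c x) (hy : MBd d y) :
    MBd (c + d) (x * y) := by
  intro i j
  rw [Matrix.mul_apply]
  exact Bd.sum _ _ fun a _ => (hx i a).mul (hy a j)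

theorem MBd.exists [Fintype ι] [Fintype κ] (X : Matrix ι κ (LaurentSeries k)) :
    ∃ c, MBd c X := by
  obtain ⟨c, hc⟩ := Bd.exists_unif (Finset.univ : Finset (ι × κ)) (fun ij => X ij.1 ij.2)
  exact ⟨c, fun i j => hc (i, j) (Finset.mem_univ _)⟩

theorem MBd.one [DecidableEq ι] : MBd 0 (1 : Matrix ι ι (LaurentSeries k)) := by
  intro i j
  rw [Matrix.one_apply]
  split_ifs
  · exact Bd.one
  · exact Bd.zero 0

theorem MBd.exists_lim (m : ℤ) (x : ℕ → Matrix ι κ (LaurentSeries k))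
    (hx : ∀ j : ℕ, MBd (m + j) (x j)) :
    ∃ X : Matrix ι κ (LaurentSeries k),
      ∀ J : ℕ, MBd (m + J) (X - ∑ j ∈ Finset.range J, x j) := by
  have hf : ∀ a b, ∀ s : ℤ, s < m →
      (∑ j ∈ Finset.range (s - m + 1).toNat, (x j a b).coeff s) = 0 := by
    intro a b s hs
    exact Finset.sum_eq_zero fun j _ => hx j a b s (by omega)
  refine ⟨Matrix.of fun a b => HahnSeries.ofSuppBddBelow
    (fun s => ∑ j ∈ Finset.range (s - m + 1).toNat, (x j a b).coeff s)
    (HahnSeries.forallLTEqZero_supp_BddBelow _ m (hf a b)), ?_⟩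
  intro J a b s hs
  rw [Matrix.sub_apply, Matrix.sum_apply, HahnSeries.coeff_sub, HahnSeries.coeff_sum,
    Matrix.of_apply, HahnSeries.coeff_ofSuppBddBelow, sub_eq_zero]
  refine Finset.sum_subset ?_ ?_
  · intro j hj
    simp only [Finset.mem_range] at *
    omega
  · intro j _ hj
    simp only [Finset.mem_range] at *
    exact hx j a b s (by omega)

/-- Successive approximation. -/
theorem approx (F : Matrix ι κ (LaurentSeries k) →+ Matrix ι κ (LaurentSeries k)) (c e : ℤ)
    (hF : ∀ m X, MBd m X → MBd (m - e) (F X))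
    (happ : ∀ m Y, MBd m Y → ∃ X, MBd (m - c) X ∧ MBd (m + 1) (Y - F X))
    (m : ℤ) (Y : Matrix ι κ (LaurentSeries k)) (hY : MBd m Y) :
    ∃ X, MBd (m - c) X ∧ F X = Y := by
  choose! R hR1 hR2 using happ
  let y : ℕ → Matrix ι κ (LaurentSeries k) :=
    fun j => Nat.rec Y (fun j z => z - F (R (m + j) z)) j
  have hys : ∀ j : ℕ, y (j + 1) = y j - F (R (m + j) (y j)) := fun j => rfl
  have hy : ∀ j : ℕ, MBd (m + j) (y j) := by
    intro j
    induction j with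
    | zero =>
      have h0 : m + ((0 : ℕ) : ℤ) = m := by simp
      rw [h0]; exact hY
    | succ j ih =>
      rw [hys]
      refine (hR2 _ _ ih).mono ?_
      push_cast; omega
  obtain ⟨X, hX⟩ := MBd.exists_lim (m - c) (fun j => R (m + j) (y j)) (fun j =>
    (hR1 _ _ (hy j)).mono (by omega))
  have hsum : ∀ J : ℕ, F (∑ j ∈ Finset.range J, R (m + j) (y j)) = Y - y J := by
    intro J
    induction J with
    | zero => simp [y]
    | succ J ih =>
      rw [Finset.sum_range_succ, map_add, ih, hys]
      abel
  refine ⟨X, by simpa using hX 0, ?_⟩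
  rw [← sub_eq_zero]
  ext1 a b
  refine Bd.eq_zero fun J => ?_
  obtain ⟨N, hN1, hN2⟩ : ∃ N : ℕ, (J : ℤ) ≤ m - c + N - e ∧ (J : ℤ) ≤ m + N :=
    ⟨J + (m - c - e).natAbs + m.natAbs, by omega, by omega⟩
  refine ⟨(J : ℤ), le_rfl, ?_⟩
  have h1 : F X - Y = F (X - ∑ j ∈ Finset.range N, R (m + j) (y j)) - y N := by
    rw [map_sub, hsum]; abel
  rw [h1]
  refine (MBd.sub ((hF _ _ (hX N)).mono ?_) ((hy N).mono ?_)) a b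
  · assumption
  · assumption

end mat

section frob
variable {q : ℕ} {σL : LaurentSeries k →+* LaurentSeries k}

theorem Bd.sigma (hq : 2 ≤ q)
    (hσL : ∀ (x : LaurentSeries k) (m : ℤ), (σL x).coeff m = x.coeff m ^ q)
    {c : ℤ} {x : LaurentSeries k} (hx : Bd c x) : Bd c (σL x) := by
  intro s hs
  rw [hσL, hx s hs, zero_pow (by omega)]

theorem coeff_iter
    (hσL : ∀ (x : LaurentSeries k) (m : ℤ), (σL x).coeff m = x.coeff m ^ q)
    (i : ℕ) (x : LaurentSeries k) (m : ℤ) : ((σL ^ i) x).coeff m = x.coeff m ^ (q ^ i) := by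
  induction i with
  | zero => simp
  | succ i ih => rw [pow_succ', RingHom.mul_def, RingHom.comp_apply, hσL, ih, ← pow_mul, pow_succ]

theorem Bd.iter (hq : 2 ≤ q)
    (hσL : ∀ (x : LaurentSeries k) (m : ℤ), (σL x).coeff m = x.coeff m ^ q)
    (i : ℕ) {c : ℤ} {x : LaurentSeries k} (hx : Bd c x) : Bd c ((σL ^ i) x) := by
  intro s hs
  rw [coeff_iter hσL, hx s hs, zero_pow]
  exact pow_ne_zero _ (by omega)

open Polynomial in
theorem scalar_root [IsAlgClosed k] (hq : 2 ≤ q) (d : ℕ) (a : ℕ → k) (i0 : ℕ) (hi0 : i0 < d)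
    (ha : a i0 ≠ 0) (y : k) : ∃ t : k, ∑ i ∈ Finset.range d, a i * t ^ (q ^ i) = y := by
  let P : k[X] := ∑ i ∈ Finset.range d, C (a i) * X ^ (q ^ i) - C y
  have hP : P.coeff (q ^ i0) = a i0 := by
    have hne : q ^ i0 ≠ 0 := pow_ne_zero _ (by omega)
    simp only [P, coeff_sub, finsetSum_coeff, coeff_C_mul, coeff_X_pow, coeff_C, if_neg hne,
      sub_zero]
    rw [Finset.sum_eq_single i0]
    · simp
    · intro b _ hb
      rw [if_neg, mul_zero]
      intro h
      exact hb (Nat.pow_right_injective hq h).symm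
    · intro h
      exact absurd (Finset.mem_range.2 hi0) h
  have hdeg : P.degree ≠ 0 := by
    intro h
    have h2 := Polynomial.coeff_eq_zero_of_degree_lt (p := P) (n := q ^ i0) (by
      rw [h]
      have : 0 < q ^ i0 := pow_pos (by omega) _
      exact_mod_cast this)
    exact ha (hP ▸ h2)
  obtain ⟨t, ht⟩ := IsAlgClosed.exists_root P hdeg
  refine ⟨t, ?_⟩
  have := ht
  simp only [P, IsRoot, eval_sub, eval_finsetSum, eval_mul, eval_C, eval_pow, eval_X] at this
  exact sub_eq_zero.1 this

theorem scalar_solve [IsAlgClosed k] (hq : 2 ≤ q)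
    (hσL : ∀ (x : LaurentSeries k) (m : ℤ), (σL x).coeff m = x.coeff m ^ q)
    (d : ℕ) (α : ℕ → LaurentSeries k) (i1 : ℕ) (hi1 : i1 < d) (hα : α i1 ≠ 0) :
    ∃ c : ℤ, ∀ m β, Bd m β → ∃ t, Bd (m - c) t ∧
      ∑ i ∈ Finset.range d, α i * (σL ^ i) t = β := by
  classical
  obtain ⟨i0, hi0, hmin⟩ := Finset.exists_min_image
    ((Finset.range d).filter fun i => α i ≠ 0) (fun i => (α i).order)
    ⟨i1, by simp [hi1, hα]⟩
  simp only [Finset.mem_filter, Finset.mem_range] at hi0 hmin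
  set ν := (α i0).order with hν
  have hB : ∀ i < d, Bd ν (α i) := by
    intro i hi
    by_cases h : α i = 0
    · rw [h]; exact Bd.zero _
    · exact fun s hs => HahnSeries.coeff_eq_zero_of_lt_order (lt_of_lt_of_le hs (hmin i ⟨hi, h⟩))
  have hlead : (α i0).coeff ν ≠ 0 := fun h => hi0.2 (HahnSeries.coeff_order_eq_zero.1 h)
  let f : LaurentSeries k →+ LaurentSeries k :=
    ∑ i ∈ Finset.range d, (AddMonoidHom.mulLeft (α i)).comp ((σL ^ i : LaurentSeries k →+* LaurentSeries k) : LaurentSeries k →+ LaurentSeries k)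
  have hf : ∀ t, f t = ∑ i ∈ Finset.range d, α i * (σL ^ i) t := by
    intro t
    simp [f]
  have hfB : ∀ m t, Bd m t → Bd (m + ν) (f t) := by
    intro m t ht
    rw [hf]
    refine Bd.sum _ _ fun i hi => ?_
    rw [add_comm]
    exact (hB i (Finset.mem_range.1 hi)).mul (ht.iter hq hσL i)
  let F : Matrix Unit Unit (LaurentSeries k) →+ Matrix Unit Unit (LaurentSeries k) :=
    { toFun := fun X => Matrix.of fun _ _ => f (X () ())
      map_zero' := by ext; simp
      map_add' := by intro x y; ext; simp }
  refine ⟨ν, fun m β hβ => ?_⟩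
  obtain ⟨X, hX, hFX⟩ := approx F ν (-ν) (fun m X hX _ _ => by
      rw [sub_neg_eq_add]; exact hfB _ _ (hX () ())) (fun m Y hY => by
      obtain ⟨τ, hτ⟩ := scalar_root hq d (fun i => (α i).coeff ν) i0 hi0.1 hlead
        ((Y () ()).coeff m)
      have hs : Bd (m - ν) (HahnSeries.single (m - ν) τ : LaurentSeries k) := by
        intro s hs
        exact HahnSeries.coeff_single_of_ne hs.ne
      refine ⟨Matrix.of fun _ _ => HahnSeries.single (m - ν) τ, fun _ _ => hs, ?_⟩
      intro _ _ s hs'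
      change (Y () () - f (HahnSeries.single (m - ν) τ)).coeff s = 0
      rcases lt_or_eq_of_le (Int.lt_add_one_iff.1 hs') with h | h
      · exact ((hY () ()).sub ((hfB _ _ hs).mono (by omega))) s h
      · rw [HahnSeries.coeff_sub, h, ← hτ, hf, HahnSeries.coeff_sum, sub_eq_zero]
        refine Finset.sum_congr rfl fun i _ => ?_
        have : (σL ^ i) (HahnSeries.single (m - ν) τ) = HahnSeries.single (m - ν) (τ ^ q ^ i) := by
          ext s
          rw [coeff_iter hσL]
          by_cases hsm : s = m - ν
          · subst hsm; simp
          · rw [HahnSeries.coeff_single_of_ne hsm, HahnSeries.coeff_single_of_ne hsm, zero_pow]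
            exact pow_ne_zero _ (by omega)
        rw [this]
        have := HahnSeries.coeff_mul_single_add (r := τ ^ q ^ i) (x := α i) (a := ν) (b := m - ν)
        rw [add_sub_cancel] at this
        exact this.symm) m (Matrix.of fun _ _ => β) (fun _ _ => hβ)
  refine ⟨X () (), hX () (), ?_⟩
  rw [← hf]
  exact congrFun (congrFun hFX ()) ()

end frob

section semilin
variable {q n : ℕ} {σL : LaurentSeries k →+* LaurentSeries k}

theorem exists_rel_s1 (E : ℕ → Matrix (Fin n) (Fin n) (LaurentSeries k)) :
    ∃ (D : ℕ) (g : ℕ → LaurentSeries k) (i1 : ℕ), i1 < D + 1 ∧ g i1 ≠ 0 ∧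
      ∑ i ∈ Finset.range (D + 1), g i • E i = 0 := by
  let D := Module.finrank (LaurentSeries k) (Matrix (Fin n) (Fin n) (LaurentSeries k))
  have h : ¬ LinearIndependent (LaurentSeries k) (fun i : Fin (D + 1) => E i) := by
    intro h
    have := h.fintype_card_le_finrank
    simp only [Fintype.card_fin] at this
    omega
  obtain ⟨g, hg, i1, hi1⟩ := Fintype.not_linearIndependent_iff.1 h
  refine ⟨D, fun i => if h : i < D + 1 then g ⟨i, h⟩ else 0, i1, i1.2, ?_, ?_⟩
  · simp only [dif_pos i1.2]; exact hi1
  · rw [Finset.sum_range, ← hg]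
    refine Finset.sum_congr rfl fun i _ => ?_
    simp only [dif_pos i.2]

theorem vec_solve [IsAlgClosed k] (hq : 2 ≤ q)
    (hσL : ∀ (x : LaurentSeries k) (m : ℤ), (σL x).coeff m = x.coeff m ^ q)
    (Φ : Matrix (Fin n) (Fin n) (LaurentSeries k) →+ Matrix (Fin n) (Fin n) (LaurentSeries k))
    (hΦ : ∀ (a : LaurentSeries k) X, Φ (a • X) = σL a • Φ X)
    (E : Matrix (Fin n) (Fin n) (LaurentSeries k)) :
    ∃ c : ℤ, ∀ (m : ℤ) (a : LaurentSeries k), Bd m a → ∃ X, MBd (m - c) X ∧ Φ X - X = a • E := by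
  obtain ⟨D, g, i1, hi1, hg1, hrel⟩ := exists_rel_s1 (fun i => Φ^[i] E)
  obtain ⟨c1, hc1⟩ := scalar_solve hq hσL (D + 1) (fun i => (σL ^ i) (g (D - i))) (D - i1)
    (by omega) (by
      have : D - (D - i1) = i1 := by omega
      rw [this]
      exact fun h => hg1 ((map_eq_zero _).1 h))
  obtain ⟨γ, hγ⟩ := Bd.exists_unif (Finset.range (D + 1)) g
  obtain ⟨δ, hδ⟩ : ∃ δ, ∀ i ∈ Finset.range D, MBd δ (Φ^[i] E) := by
    obtain ⟨δ, h⟩ := Bd.exists_unif (Finset.range D ×ˢ (Finset.univ : Finset (Fin n × Fin n)))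
      (fun z => (Φ^[z.1] E) z.2.1 z.2.2)
    exact ⟨δ, fun i hi a b => h (i, a, b) (by simpa using hi)⟩
  refine ⟨max 0 (c1 - γ) - δ, fun m a ha => ?_⟩
  obtain ⟨l, hl, hleq⟩ := hc1 m (-(σL ^ D) a) (ha.iter hq hσL D).neg
  let c : ℕ → LaurentSeries k :=
    fun j => Nat.rec (-a - l * g 0) (fun j z => σL z - l * g (j + 1)) j
  have hc0 : c 0 = -a - l * g 0 := rfl
  have hcs : ∀ j, c (j + 1) = σL (c j) - l * g (j + 1) := fun j => rfl
  have hcl : ∀ j, c j = -(σL ^ j) a - ∑ i ∈ Finset.range (j + 1), (σL ^ i) (l * g (j - i)) := by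
    intro j
    induction j with
    | zero => simp [hc0]
    | succ j ih =>
      rw [hcs, ih, Finset.sum_range_succ' _ (j + 1)]
      simp only [map_sub, map_neg, map_sum, Nat.add_sub_add_right, pow_succ', pow_zero,
        RingHom.mul_def, RingHom.comp_apply, RingHom.one_def, RingHom.id_apply, Nat.sub_zero]
      ring
  have hcD : c D = 0 := by
    rw [hcl, sub_eq_zero, ← hleq]
    refine Finset.sum_congr rfl fun i _ => ?_
    rw [map_mul, mul_comm]
  have hcB : ∀ j, j < D + 1 → Bd (m - max 0 (c1 - γ)) (c j) := by
    have hlg : ∀ j, j < D + 1 → Bd (m - max 0 (c1 - γ)) (l * g j) := fun j hj =>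
      (hl.mul (hγ j (Finset.mem_range.2 hj))).mono (by omega)
    intro j
    induction j with
    | zero => intro h; exact (ha.neg.mono (by omega)).sub (hlg 0 h)
    | succ j ih => intro h; exact ((ih (by omega)).sigma hq hσL).sub (hlg _ h)
  have key : ∀ j : ℕ, Φ (∑ i ∈ Finset.range j, c i • Φ^[i] E) - ∑ i ∈ Finset.range j, c i • Φ^[i] E
      = a • E + l • ∑ i ∈ Finset.range (j + 1), g i • Φ^[i] E + c j • Φ^[j] E := by
    intro j
    induction j with
    | zero =>
      simp only [Finset.range_zero, Finset.sum_empty, map_zero, Finset.sum_range_one,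
        Function.iterate_zero, id, hc0, zero_add]
      simp only [sub_smul, smul_add, neg_smul, mul_smul]
      abel
    | succ j ih =>
      rw [Finset.sum_range_succ, map_add, hΦ, ← Function.iterate_succ_apply' Φ,
        Finset.sum_range_succ _ (j + 1), hcs]
      rw [sub_eq_iff_eq_add] at ih
      rw [ih]
      simp only [sub_smul, smul_add, neg_smul, mul_smul]
      abel
  refine ⟨∑ i ∈ Finset.range D, c i • Φ^[i] E, ?_, ?_⟩
  · refine MBd.sum _ _ fun i hi => ?_
    refine (MBd.smul (hcB i (by have := Finset.mem_range.1 hi; omega)) (hδ i hi)).mono (by omega)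
  · rw [key, hrel, hcD, smul_zero, zero_smul, add_zero, add_zero]

theorem mat_solve [IsAlgClosed k] (hq : 2 ≤ q)
    (hσL : ∀ (x : LaurentSeries k) (m : ℤ), (σL x).coeff m = x.coeff m ^ q)
    (Φ : Matrix (Fin n) (Fin n) (LaurentSeries k) →+ Matrix (Fin n) (Fin n) (LaurentSeries k))
    (hΦ : ∀ (a : LaurentSeries k) X, Φ (a • X) = σL a • Φ X) :
    ∃ c : ℤ, ∀ m Y, MBd m Y → ∃ X, MBd (m - c) X ∧ Φ X - X = Y := by
  choose c hc using fun ij : Fin n × Fin n =>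
    vec_solve hq hσL Φ hΦ (Matrix.single ij.1 ij.2 1)
  obtain ⟨C, hC⟩ := (Set.finite_range c).bddAbove
  refine ⟨C, fun m Y hY => ?_⟩
  choose X hX hXe using fun ij : Fin n × Fin n => hc ij m (Y ij.1 ij.2) (hY ij.1 ij.2)
  refine ⟨∑ ij, X ij, MBd.sum _ _ fun ij _ => (hX ij).mono ?_, ?_⟩
  · have := hC (Set.mem_range_self ij)
    omega
  · rw [map_sum, ← Finset.sum_sub_distrib]
    simp only [hXe]
    rw [Fintype.sum_prod_type]
    conv_rhs => rw [Matrix.matrix_eq_sum_single Y]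
    simp [Matrix.smul_single]

theorem exists_inv (X : Matrix (Fin n) (Fin n) (LaurentSeries k)) (hX : MBd 1 X) :
    ∃ g : GL (Fin n) (LaurentSeries k), InK g ∧
      (g : Matrix (Fin n) (Fin n) (LaurentSeries k)) = 1 + X := by
  obtain ⟨Z, hZ, hZe⟩ := approx (AddMonoidHom.mulLeft (1 + X)) 0 0
    (fun m Y hY => by
      have := (MBd.add MBd.one (hX.mono (by omega : (0 : ℤ) ≤ 1))).mul hY
      simpa using this)
    (fun m Y hY => by
      refine ⟨Y, by simpa using hY, ?_⟩
      have h : Y - (AddMonoidHom.mulLeft (1 + X)) Y = -(X * Y) := by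
        simp [add_mul]
      rw [h, add_comm m 1]
      exact (hX.mul hY).neg) 0 1 MBd.one
  have h1 : (1 + X) * Z = 1 := hZe
  refine ⟨⟨1 + X, Z, h1, mul_eq_one_comm.1 h1⟩, ⟨?_, ?_⟩, rfl⟩
  · exact MBd.add MBd.one (hX.mono (by omega : (0 : ℤ) ≤ 1))
  · exact hZ

theorem core [IsAlgClosed k] (hq : 2 ≤ q)
    (hσL : ∀ (x : LaurentSeries k) (m : ℤ), (σL x).coeff m = x.coeff m ^ q)
    (b : GL (Fin n) (LaurentSeries k)) :
    ∃ M : ℕ, ∀ v : GL (Fin n) (LaurentSeries k),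
      MBd M ((v : Matrix (Fin n) (Fin n) (LaurentSeries k)) - 1) →
      ∃ g, InK g ∧ v * b = g⁻¹ * b * Units.map (RingHom.mapMatrix σL).toMonoidHom g := by
  let S : Matrix (Fin n) (Fin n) (LaurentSeries k) →+* Matrix (Fin n) (Fin n) (LaurentSeries k) :=
    RingHom.mapMatrix σL
  let Φ : Matrix (Fin n) (Fin n) (LaurentSeries k) →+ Matrix (Fin n) (Fin n) (LaurentSeries k) :=
    { toFun := fun X => b.val * S X * (b⁻¹).val
      map_zero' := by simp
      map_add' := by intro X Y; rw [map_add, mul_add, add_mul] }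
  have hΦd : ∀ X, Φ X = b.val * S X * (b⁻¹).val := fun _ => rfl
  have hS : ∀ (a : LaurentSeries k) X, S (a • X) = σL a • S X := by
    intro a X; ext1 i j; simp [S]
  have hΦ : ∀ (a : LaurentSeries k) X, Φ (a • X) = σL a • Φ X := by
    intro a X
    rw [hΦd, hΦd, hS, Matrix.mul_smul, Matrix.smul_mul]
  obtain ⟨c, hc⟩ := mat_solve hq hσL Φ hΦ
  obtain ⟨e1, he1⟩ := MBd.exists b.val
  obtain ⟨e2, he2⟩ := MBd.exists (b⁻¹).val
  have hΦB : ∀ m X, MBd m X → MBd (m + e1 + e2) (Φ X) := by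
    intro m X hX
    have hSX : MBd m (S X) := fun i j => (hX i j).sigma hq hσL
    exact ((he1.mul hSX).mul he2).mono (by omega)
  refine ⟨(c + 1).toNat, fun v hv => ?_⟩
  set M := (c + 1).toNat
  have hM : c + 1 ≤ (M : ℤ) := Int.self_le_toNat _
  set V := v.val - 1 with hV
  let F : Matrix (Fin n) (Fin n) (LaurentSeries k) →+ Matrix (Fin n) (Fin n) (LaurentSeries k) :=
    Φ - AddMonoidHom.mulRight v.val
  have hFd : ∀ X, F X = Φ X - X - X * V := by
    intro X
    simp only [F, AddMonoidHom.sub_apply, AddMonoidHom.mulRight_apply, hV, mul_sub, mul_one]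
    abel
  obtain ⟨X, hX, hFX⟩ := approx F c (|e1 + e2|)
    (fun m X hX => by
      rw [hFd]
      refine MBd.sub (MBd.sub ((hΦB m X hX).mono ?_) (hX.mono ?_)) ((hX.mul hv).mono ?_)
      · have := neg_abs_le (e1 + e2); omega
      · have := abs_nonneg (e1 + e2); omega
      · have := abs_nonneg (e1 + e2); omega)
    (fun m Y hY => by
      obtain ⟨X, hX, hXe⟩ := hc m Y hY
      refine ⟨X, hX, ?_⟩
      rw [hFd, hXe, sub_sub_cancel]
      exact (hX.mul hv).mono (by omega)) M V hv
  obtain ⟨g, hgK, hg⟩ := exists_inv X (hX.mono (by omega))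
  refine ⟨g, hgK, ?_⟩
  have hΦ1 : Φ 1 = 1 := by
    rw [hΦd, map_one, mul_one]; exact b.mul_inv
  have h1 : Φ g.val = g.val * v.val := by
    have hv1 : v.val = 1 + V := by rw [hV]; abel
    rw [hg, map_add, hΦ1, hv1]
    rw [hFd] at hFX
    have h2 : Φ X = V + X * V + X := by
      rw [sub_sub, sub_eq_iff_eq_add] at hFX
      rw [hFX]; abel
    rw [h2]; noncomm_ring
  have h2 : b * Units.map (RingHom.mapMatrix σL).toMonoidHom g * b⁻¹ = g * v := by
    ext1
    exact h1
  rw [mul_inv_eq_iff_eq_mul] at h2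
  rw [mul_assoc g⁻¹, h2]
  group

end semilin

end CentralLeaf

theorem InK.mul {k : Type*} [Field k] {n : ℕ} {g h : GL (Fin n) (LaurentSeries k)}
    (hg : InK g) (hh : InK h) : InK (g * h) := by
  refine ⟨?_, ?_⟩
  · have := MBd.mul (c := 0) (d := 0) hg.1 hh.1
    exact this
  · have := MBd.mul (c := 0) (d := 0) hh.2 hg.2
    rw [mul_inv_rev]
    exact this

theorem InKm.one {k : Type*} [Field k] {n : ℕ} (m : ℕ) :
    InKm m (1 : GL (Fin n) (LaurentSeries k)) := by
  refine ⟨⟨MBd.one, ?_⟩, ?_⟩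
  · rw [inv_one]; exact MBd.one
  · intro i j s _
    simp

theorem MBd.conj {k : Type*} [Field k] {n : ℕ} {m c d : ℤ} {u h : GL (Fin n) (LaurentSeries k)}
    (hu : MBd m (u.val - 1)) (h1 : MBd c h.val) (h2 : MBd d (h⁻¹).val) :
    MBd (c + m + d) ((h * u * h⁻¹).val - 1) := by
  have : (h * u * h⁻¹).val - 1 = h.val * (u.val - 1) * (h⁻¹).val := by
    rw [mul_sub, sub_mul, mul_one, h.mul_inv]
    rfl
  rw [this]
  exact (h1.mul hu).mul h2

/-- Admissibility of central leaves: for every `b ∈ GL_n(L)` there is `m ∈ ℕ` with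
`C_b·K_m = C_b` and `K_m·C_b = C_b`, where `C_b = {g⁻¹·b·σ(g) : g ∈ K}`. -/
theorem statement1 (p r q : ℕ) [Fact p.Prime] (hr : 0 < r) (hq : q = p ^ r)
    (k : Type*) [Field k] [Algebra (GaloisField p r) k] [IsAlgClosure (GaloisField p r) k]
    (n : ℕ)
    (σL : LaurentSeries k →+* LaurentSeries k)
    (hσL : ∀ (x : LaurentSeries k) (m : ℤ), (σL x).coeff m = x.coeff m ^ q)
    (b : GL (Fin n) (LaurentSeries k)) :
    ∃ m : ℕ,
      Set.image2 (· * ·)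
          {x : GL (Fin n) (LaurentSeries k) | ∃ g, InK g ∧
            x = g⁻¹ * b * Units.map (RingHom.mapMatrix σL).toMonoidHom g}
          {u : GL (Fin n) (LaurentSeries k) | InKm m u}
        = {x : GL (Fin n) (LaurentSeries k) | ∃ g, InK g ∧
            x = g⁻¹ * b * Units.map (RingHom.mapMatrix σL).toMonoidHom g} ∧
      Set.image2 (· * ·)
          {u : GL (Fin n) (LaurentSeries k) | InKm m u}
          {x : GL (Fin n) (LaurentSeries k) | ∃ g, InK g ∧
            x = g⁻¹ * b * Units.map (RingHom.mapMatrix σL).toMonoidHom g}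
        = {x : GL (Fin n) (LaurentSeries k) | ∃ g, InK g ∧
            x = g⁻¹ * b * Units.map (RingHom.mapMatrix σL).toMonoidHom g} := by
  have hq2 : 2 ≤ q := by
    rw [hq]
    exact le_trans (Fact.out : p.Prime).two_le (Nat.le_self_pow hr.ne' p)
  have : IsAlgClosed k := IsAlgClosure.isAlgClosed (GaloisField p r)
  obtain ⟨M, hM⟩ := core hq2 hσL b
  obtain ⟨e1, he1⟩ := MBd.exists b.val
  obtain ⟨e2, he2⟩ := MBd.exists (b⁻¹).val
  let S : GL (Fin n) (LaurentSeries k) →* GL (Fin n) (LaurentSeries k) :=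
    Units.map (RingHom.mapMatrix σL).toMonoidHom
  have hS : ∀ g, InK g → InK (S g) := by
    intro g hg
    refine ⟨fun i j => Bd.sigma hq2 hσL (hg.1 i j), ?_⟩
    rw [← map_inv]
    exact fun i j => Bd.sigma hq2 hσL (hg.2 i j)
  refine ⟨M + (e1 + e2).natAbs, Set.Subset.antisymm ?_ ?_, Set.Subset.antisymm ?_ ?_⟩
  · rintro _ ⟨_, ⟨h, hh, rfl⟩, u, ⟨_, hu⟩, rfl⟩
    have hu' : MBd ((M + (e1 + e2).natAbs : ℕ) : ℤ) (u.val - 1) := hu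
    have hSh := hS h hh
    have h1 := (hu'.conj (c := 0) (d := 0) hSh.1 hSh.2).conj he1 he2
    obtain ⟨g, hg, hge⟩ := hM _ (h1.mono (by omega))
    refine ⟨g * h, hg.mul hh, ?_⟩
    change h⁻¹ * b * S h * u = (g * h)⁻¹ * b * S (g * h)
    change b * (S h * u * (S h)⁻¹) * b⁻¹ * b = g⁻¹ * b * S g at hge
    calc h⁻¹ * b * S h * u = h⁻¹ * (b * (S h * u * (S h)⁻¹) * b⁻¹ * b) * S h := by group
      _ = (g * h)⁻¹ * b * S (g * h) := by rw [hge, map_mul]; group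
  · intro x hx
    exact ⟨x, hx, 1, InKm.one _, mul_one x⟩
  · rintro _ ⟨u, ⟨_, hu⟩, _, ⟨h, hh, rfl⟩, rfl⟩
    have hu' : MBd ((M + (e1 + e2).natAbs : ℕ) : ℤ) (u.val - 1) := hu
    have h1 := hu'.conj (c := 0) (d := 0) hh.1 hh.2
    obtain ⟨g, hg, hge⟩ := hM _ (h1.mono (by omega))
    refine ⟨g * h, hg.mul hh, ?_⟩
    change u * (h⁻¹ * b * S h) = (g * h)⁻¹ * b * S (g * h)
    change h * u * h⁻¹ * b = g⁻¹ * b * S g at hge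
    calc u * (h⁻¹ * b * S h) = h⁻¹ * (h * u * h⁻¹ * b) * S h := by group
      _ = (g * h)⁻¹ * b * S (g * h) := by rw [hge, map_mul]; group
  · intro x hx
    exact ⟨1, InKm.one _, x, hx, one_mul x⟩
end

section
/- Let ε^μ = diag(ε,ε,1,1,1) and let b₃ ∈ GL₅(L) be the block diagonal matrix with two 2×2 blocks equal to [[0,1],[ε,0]] and one 1×1 block equal to (1) (a representative of the σ-conjugacy class with Newton slopes (1/2,1/2,1/2,1/2,0)). Then for every b ∈ K·ε^μ·K that is σ-conjugate in GL₅(L) to b₃, there exist t ∈ k and g ∈ K with g^{-1}·b·σ(g) = x_t, where x_t is the 5×5 matrix with rows (1,0,0,0,0), (0,0,1,t,0), (0,ε,0,0,0), (0,0,0,0,1), (0,0,0,ε,0). -/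
open scoped MatrixGroups

noncomputable section
namespace S6

variable {k : Type*} [Field k]

lemma inO_iff (x : LaurentSeries k) : InO x ↔ ∃ f : PowerSeries k, HahnSeries.ofPowerSeries ℤ k f = x := by
  constructor
  · intro h
    refine ⟨PowerSeries.mk fun n => x.coeff n, ?_⟩
    ext m
    rcases lt_or_ge m 0 with hm | hm
    · rw [h m hm]
      rw [HahnSeries.ofPowerSeries_apply, HahnSeries.embDomain_of_notMem_range]
      rintro ⟨n, hn⟩
      simp at hn
      omega
    · obtain ⟨n, rfl⟩ := Int.eq_ofNat_of_zero_le hm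
      have := HahnSeries.ofPowerSeries_apply_coeff (Γ := ℤ) (PowerSeries.mk fun n => x.coeff n) n
      simp
  · rintro ⟨f, rfl⟩ m hm
    rw [HahnSeries.ofPowerSeries_apply, HahnSeries.embDomain_of_notMem_range]
    rintro ⟨n, hn⟩
    simp at hn
    omega

lemma InO.add {x y : LaurentSeries k} (hx : InO x) (hy : InO y) : InO (x + y) := by
  intro m hm; simp [hx m hm, hy m hm]
lemma InO.neg {x : LaurentSeries k} (hx : InO x) : InO (-x) := by
  intro m hm; simp [hx m hm]
lemma InO.mul {x y : LaurentSeries k} (hx : InO x) (hy : InO y) : InO (x * y) := by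
  rw [inO_iff] at *
  obtain ⟨f, rfl⟩ := hx
  obtain ⟨g, rfl⟩ := hy
  exact ⟨f * g, map_mul _ _ _⟩
lemma InO.sum {ι : Type*} (s : Finset ι) (f : ι → LaurentSeries k) (h : ∀ i ∈ s, InO (f i)) :
    InO (∑ i ∈ s, f i) := by
  intro m hm
  rw [HahnSeries.coeff_sum]
  exact Finset.sum_eq_zero fun i hi => h i hi m hm
lemma inO_zero : InO (0 : LaurentSeries k) := by intro m _; simp
lemma inO_C (a : k) : InO (HahnSeries.C a : LaurentSeries k) := by
  intro m hm
  rw [HahnSeries.C_apply, HahnSeries.coeff_single_of_ne hm.ne]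
lemma inO_single {j : ℤ} (hj : 0 ≤ j) (a : k) : InO (HahnSeries.single j a : LaurentSeries k) := by
  intro m hm
  rw [HahnSeries.coeff_single_of_ne (by omega)]

lemma InO.mulVec {n : ℕ} {M : Matrix (Fin n) (Fin n) (LaurentSeries k)} {v : Fin n → LaurentSeries k}
    (hM : ∀ i j, InO (M i j)) (hv : ∀ i, InO (v i)) (i) : InO ((M.mulVec v) i) := by
  rw [Matrix.mulVec, dotProduct]
  exact InO.sum _ _ fun j _ => InO.mul (hM i j) (hv j)

lemma coeff_single_mul' (j : ℤ) (a : k) (x : LaurentSeries k) (i : ℤ) :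
    ((HahnSeries.single j a : LaurentSeries k) * x).coeff i = a * x.coeff (i - j) := by
  have := HahnSeries.coeff_single_mul_add (r := a) (x := x) (a := i - j) (b := j)
  rwa [sub_add_cancel] at this

lemma exists_series (f : ℤ → k) (A : ℤ) (h : ∀ i < A, f i = 0) :
    ∃ x : LaurentSeries k, ∀ i, x.coeff i = f i := by
  refine ⟨HahnSeries.ofSuppBddBelow f ⟨A, ?_⟩, fun i => rfl⟩
  intro i hi
  by_contra hc
  exact hi (h i (by omega))

lemma exists_bound (x : LaurentSeries k) : ∃ A : ℤ, ∀ i < A, x.coeff i = 0 :=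
  ⟨x.order, fun _ hi => HahnSeries.coeff_eq_zero_of_lt_order hi⟩

lemma exists_bound_mat {n : ℕ} (M : Matrix (Fin n) (Fin n) (LaurentSeries k)) :
    ∃ A : ℤ, ∀ i j, InO (HahnSeries.single (-A) 1 * M i j) := by
  choose f hf using fun i j => exists_bound (M i j)
  obtain ⟨A, hA⟩ := (Set.finite_range fun x : Fin n × Fin n => f x.1 x.2).bddBelow
  refine ⟨A, fun i j m hm => ?_⟩
  rw [coeff_single_mul', hf, mul_zero]
  have := hA ⟨(i, j), rfl⟩
  simp only at this
  omega

/-- Coefficients of the expansion in powers of the uniformizer `Π` with `Π² = ε`. -/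
def cf (u : LaurentSeries k × LaurentSeries k) (i : ℤ) : k :=
  if i % 2 = 0 then u.2.coeff (i / 2) else u.1.coeff (i / 2)

def pw (n : ℤ) : LaurentSeries k × LaurentSeries k :=
  if n % 2 = 0 then (0, HahnSeries.single (n / 2) 1) else (HahnSeries.single (n / 2) 1, 0)

lemma cf_even (u : LaurentSeries k × LaurentSeries k) (j : ℤ) : cf u (2 * j) = u.2.coeff j := by
  simp [cf]
lemma cf_odd (u : LaurentSeries k × LaurentSeries k) (j : ℤ) : cf u (2 * j + 1) = u.1.coeff j := by
  have h1 : (2 * j + 1) % 2 = 1 := by omega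
  have h2 : (2 * j + 1) / 2 = j := by omega
  simp [cf, h1, h2]

lemma cf_ext {u v : LaurentSeries k × LaurentSeries k} (h : ∀ i, cf u i = cf v i) : u = v := by
  ext j
  · simpa [cf_odd] using h (2 * j + 1)
  · simpa [cf_even] using h (2 * j)

lemma cf_add (u v : LaurentSeries k × LaurentSeries k) (i) : cf (u + v) i = cf u i + cf v i := by
  unfold cf; split_ifs <;> simp
lemma cf_sub (u v : LaurentSeries k × LaurentSeries k) (i) : cf (u - v) i = cf u i - cf v i := by
  unfold cf; split_ifs <;> simp
lemma cf_zero (i) : cf (0 : LaurentSeries k × LaurentSeries k) i = 0 := by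
  unfold cf; split_ifs <;> simp
lemma cf_single (j : ℤ) (a : k) (u : LaurentSeries k × LaurentSeries k) (i) :
    cf ((HahnSeries.single j a : LaurentSeries k) • u) i = a * cf u (i - 2 * j) := by
  have h1 : (i - 2 * j) % 2 = i % 2 := by omega
  have h2 : (i - 2 * j) / 2 = i / 2 - j := by omega
  unfold cf; rw [h1, h2]; split_ifs <;> simp [coeff_single_mul']
lemma cf_C (a : k) (u : LaurentSeries k × LaurentSeries k) (i) :
    cf ((HahnSeries.C a : LaurentSeries k) • u) i = a * cf u i := by
  rw [HahnSeries.C_apply, cf_single]; simp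

lemma cf_pw (n i : ℤ) : cf (pw n : LaurentSeries k × LaurentSeries k) i = if i = n then 1 else 0 := by
  unfold cf pw
  split_ifs with h1 h2 h3 h4 h5 <;> simp [HahnSeries.coeff_single] <;> omega

lemma exists_cf (f : ℤ → k) (A : ℤ) (h : ∀ i < A, f i = 0) :
    ∃ u : LaurentSeries k × LaurentSeries k, ∀ i, cf u i = f i := by
  obtain ⟨x, hx⟩ := exists_series (fun j => f (2 * j + 1)) (A / 2 - 1) fun j hj => h _ (by omega)
  obtain ⟨y, hy⟩ := exists_series (fun j => f (2 * j)) (A / 2 - 1) fun j hj => h _ (by omega)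
  refine ⟨(x, y), fun i => ?_⟩
  rcases Int.even_or_odd' i with ⟨j, rfl | rfl⟩
  · rw [cf_even, hy]
  · rw [cf_odd, hx]

lemma exists_bound_cf (u : LaurentSeries k × LaurentSeries k) : ∃ A : ℤ, ∀ i < A, cf u i = 0 := by
  obtain ⟨A, hA⟩ := exists_bound u.1
  obtain ⟨B, hB⟩ := exists_bound u.2
  refine ⟨2 * min A B, fun i hi => ?_⟩
  rcases Int.even_or_odd' i with ⟨j, rfl | rfl⟩
  · rw [cf_even, hB _ (by omega)]
  · rw [cf_odd, hA _ (by omega)]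

lemma fil_span (n : ℤ) (u : LaurentSeries k × LaurentSeries k) (h : ∀ i < n, cf u i = 0) :
    ∃ a b : LaurentSeries k, InO a ∧ InO b ∧ u = a • pw n + b • pw (n + 1) := by
  have key : ∀ (j : ℤ) (x : LaurentSeries k), (∀ i < j, x.coeff i = 0) →
      ∃ a, InO a ∧ x = a * HahnSeries.single j 1 := by
    intro j x hx
    refine ⟨HahnSeries.single (-j) 1 * x, ?_, ?_⟩
    · intro m hm
      rw [coeff_single_mul', hx _ (by omega), mul_zero]
    · rw [mul_right_comm, HahnSeries.single_mul_single]; simp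
  rcases Int.even_or_odd' n with ⟨j, rfl | rfl⟩
  · obtain ⟨a, ha, ha'⟩ := key j u.2 fun i hi => by rw [← cf_even]; exact h _ (by omega)
    obtain ⟨b, hb, hb'⟩ := key j u.1 fun i hi => by rw [← cf_odd]; exact h _ (by omega)
    refine ⟨a, b, ha, hb, ?_⟩
    have h1 : (2 * j + 1) % 2 = 1 := by omega
    have h2 : (2 * j + 1) / 2 = j := by omega
    ext1 <;> simp [pw, h1, h2, ← ha', ← hb']
  · obtain ⟨a, ha, ha'⟩ := key j u.1 fun i hi => by rw [← cf_odd]; exact h _ (by omega)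
    obtain ⟨b, hb, hb'⟩ := key (j + 1) u.2 fun i hi => by rw [← cf_even]; exact h _ (by omega)
    refine ⟨a, b, ha, hb, ?_⟩
    have h1 : (2 * j + 1) % 2 = 1 := by omega
    have h2 : (2 * j + 1) / 2 = j := by omega
    have h3 : (2 * j + 1 + 1) % 2 = 0 := by omega
    have h4 : (2 * j + 1 + 1) / 2 = j + 1 := by omega
    ext1 <;> simp [pw, h1, h2, h3, h4, ← ha', ← hb']

/-- A lattice stable under an operator raising the filtration by one is a filtration step. -/
lemma lat {N : Type*} [AddCommGroup N] [Module (LaurentSeries k) N] (c : N → ℤ → k)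
    (hsub : ∀ u v i, c (u - v) i = c u i - c v i)
    (hC : ∀ (a : k) u i, c ((HahnSeries.C a : LaurentSeries k) • u) i = a * c u i)
    (φ : N → N) (hφ : ∀ u i, c (φ u) (i + 1) = 0 ↔ c u i = 0)
    (P : AddSubgroup N) (hPC : ∀ (a : k), ∀ u ∈ P, (HahnSeries.C a : LaurentSeries k) • u ∈ P)
    (hPφ : ∀ u ∈ P, φ u ∈ P)
    (A B : ℤ) (hA : ∀ u ∈ P, ∀ i < A, c u i = 0) (hB : ∀ u, (∀ i < B, c u i = 0) → u ∈ P)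
    (hne : ∃ u, (∀ i < B, c u i = 0) ∧ c u B ≠ 0) :
    ∃ m : ℤ, ∀ u, u ∈ P ↔ ∀ i < m, c u i = 0 := by
  classical
  obtain ⟨m, ⟨u0, hu0, hm⟩, hmin⟩ := Int.exists_least_of_bdd (P := fun m => ∃ u ∈ P, c u m ≠ 0)
    ⟨A, fun z ⟨u, hu, hz⟩ => by
      by_contra hc
      exact hz (hA u hu z (by omega))⟩
    (by obtain ⟨u, h1, h2⟩ := hne; exact ⟨B, u, hB u h1, h2⟩)
  have hPm : ∀ u ∈ P, ∀ i < m, c u i = 0 := by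
    intro u hu i hi
    by_contra hc
    have := hmin i ⟨u, hu, hc⟩
    omega
  refine ⟨m, fun u => ⟨hPm u, ?_⟩⟩
  have hel : ∀ d : ℕ, ∃ u ∈ P, (∀ i < m + d, c u i = 0) ∧ c u (m + d) ≠ 0 := by
    intro d
    induction d with
    | zero => exact ⟨u0, hu0, by simpa using hPm u0 hu0, by simpa using hm⟩
    | succ d ih =>
      obtain ⟨u, hu, h1, h2⟩ := ih
      refine ⟨φ u, hPφ u hu, fun i hi => ?_, ?_⟩
      · have := (hφ u (i - 1)).2 (h1 _ (by push_cast at hi; omega))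
        simpa using this
      · have := (hφ u (m + d)).not.2 h2
        push_cast
        rwa [← add_assoc]
  have hdesc : ∀ d : ℕ, ∀ i : ℤ, m ≤ i → B ≤ i + d → ∀ u, (∀ j < i, c u j = 0) → u ∈ P := by
    intro d
    induction d with
    | zero => exact fun i _ hi u hu => hB u fun j hj => hu j (by push_cast at hi; omega)
    | succ d ih =>
      intro i hmi hBi u hu
      obtain ⟨e, rfl⟩ : ∃ e : ℕ, i = m + e := ⟨(i - m).toNat, by omega⟩
      obtain ⟨v, hv, h1, h2⟩ := hel e
      have : u - (HahnSeries.C (c u (m + e) / c v (m + e)) : LaurentSeries k) • v ∈ P := by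
        refine ih (m + e + 1) (by omega) (by push_cast at hBi; omega) _ fun j hj => ?_
        rw [hsub, hC]
        rcases lt_or_eq_of_le (show j ≤ m + e by omega) with h | rfl
        · rw [hu j h, h1 j h]; simp
        · rw [div_mul_cancel₀ _ h2, sub_self]
      have h3 := P.add_mem this (hPC (c u (m + e) / c v (m + e)) v hv)
      simpa using h3
  exact hdesc (B - m).toNat m le_rfl (by omega) u


/-- The ambient isocrystal: two lines of slope `1/2` and one line of slope `0`. -/
abbrev Iso (k : Type*) [Field k] :=
  (LaurentSeries k × LaurentSeries k) × (LaurentSeries k × LaurentSeries k) × LaurentSeries k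

def ph (σ : LaurentSeries k →+* LaurentSeries k) (u : LaurentSeries k × LaurentSeries k) :
    LaurentSeries k × LaurentSeries k := (σ u.2, HahnSeries.single (1 : ℤ) 1 * σ u.1)

def Fr (σ : LaurentSeries k →+* LaurentSeries k) (v : Iso k) : Iso k :=
  (ph σ v.1, ph σ v.2.1, σ v.2.2)

lemma ph_zero (σ : LaurentSeries k →+* LaurentSeries k) : ph σ 0 = 0 := by simp [ph]
lemma ph_add (σ : LaurentSeries k →+* LaurentSeries k) (u v) : ph σ (u + v) = ph σ u + ph σ v := by
  simp [ph, mul_add]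

lemma cf_ph {q : ℕ} (σ : LaurentSeries k →+* LaurentSeries k)
    (hσ : ∀ (x : LaurentSeries k) (m : ℤ), (σ x).coeff m = x.coeff m ^ q)
    (u : LaurentSeries k × LaurentSeries k) (i : ℤ) : cf (ph σ u) (i + 1) = cf u i ^ q := by
  rcases Int.even_or_odd' i with ⟨j, rfl | rfl⟩
  · rw [cf_odd, cf_even]; exact hσ _ _
  · rw [show 2 * j + 1 + 1 = 2 * (j + 1) by ring, cf_odd, cf_even]
    simp [ph, coeff_single_mul', hσ]

lemma cf_ph' {q : ℕ} (σ : LaurentSeries k →+* LaurentSeries k)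
    (hσ : ∀ (x : LaurentSeries k) (m : ℤ), (σ x).coeff m = x.coeff m ^ q)
    (u : LaurentSeries k × LaurentSeries k) (i : ℤ) : cf (ph σ u) i = cf u (i - 1) ^ q := by
  rw [← cf_ph σ hσ, sub_add_cancel]

lemma ph_pw {q : ℕ} (σ : LaurentSeries k →+* LaurentSeries k)
    (hσ : ∀ (x : LaurentSeries k) (m : ℤ), (σ x).coeff m = x.coeff m ^ q)
    (hq : q ≠ 0) (n : ℤ) : ph σ (pw n) = pw (n + 1) := by
  refine cf_ext fun i => ?_
  rw [cf_ph' σ hσ, cf_pw, cf_pw]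
  have : i - 1 = n ↔ i = n + 1 := by omega
  simp only [this]
  split_ifs <;> simp [hq]

lemma sig_single {q : ℕ} (σ : LaurentSeries k →+* LaurentSeries k)
    (hσ : ∀ (x : LaurentSeries k) (m : ℤ), (σ x).coeff m = x.coeff m ^ q)
    (hq : q ≠ 0) (a : ℤ) : σ (HahnSeries.single a 1) = HahnSeries.single a 1 := by
  ext m
  rw [hσ, HahnSeries.coeff_single]
  split_ifs <;> simp [hq]

lemma main_lat {q : ℕ} (σ : LaurentSeries k →+* LaurentSeries k)
    (hσ : ∀ (x : LaurentSeries k) (m : ℤ), (σ x).coeff m = x.coeff m ^ q)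
    [IsAlgClosed k] (hq : q ≠ 0) (Λ : AddSubgroup (Iso k))
    (hO : ∀ x : LaurentSeries k, InO x → ∀ v ∈ Λ, x • v ∈ Λ)
    (hF : ∀ v ∈ Λ, Fr σ v ∈ Λ)
    (hV : ∀ v ∈ Λ, ∀ v', Fr σ v' = (HahnSeries.single (1 : ℤ) 1 : LaurentSeries k) • v → v' ∈ Λ)
    (A B : ℤ)
    (hA : ∀ v ∈ Λ, (∀ i < A, cf v.1 i = 0) ∧ (∀ i < A, cf v.2.1 i = 0) ∧
      ∀ i < A, v.2.2.coeff i = 0)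
    (hB : ∀ v : Iso k, (∀ i < B, cf v.1 i = 0) → (∀ i < B, cf v.2.1 i = 0) →
      (∀ i < B, v.2.2.coeff i = 0) → v ∈ Λ) :
    ∃ (t : k) (e : Fin 5 → Iso k), (∀ j, e j ∈ Λ) ∧ Fr σ (e 0) = e 0 ∧
      Fr σ (e 1) = (HahnSeries.single (1 : ℤ) 1 : LaurentSeries k) • e 2 ∧
      Fr σ (e 2) = e 1 ∧
      Fr σ (e 3) = (HahnSeries.C t : LaurentSeries k) • e 1 +
        (HahnSeries.single (1 : ℤ) 1 : LaurentSeries k) • e 4 ∧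
      Fr σ (e 4) = e 3 ∧
      ∀ v ∈ Λ, ∃ c : Fin 5 → LaurentSeries k, (∀ j, InO (c j)) ∧ v = ∑ j, c j • e j := by
  -- the slope zero line
  obtain ⟨a, ha⟩ : ∃ a : ℤ, ∀ z : LaurentSeries k, ((0, 0, z) : Iso k) ∈ Λ ↔
      ∀ i < a, z.coeff i = 0 := by
    let P : AddSubgroup (LaurentSeries k) :=
      { carrier := {z | ((0, 0, z) : Iso k) ∈ Λ}
        zero_mem' := Λ.zero_mem
        add_mem' := fun {x y} hx hy => by simpa using Λ.add_mem hx hy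
        neg_mem' := fun {x} hx => by simpa using Λ.neg_mem hx }
    refine lat (fun z i => z.coeff i) (by simp) (by intro a u i; simp)
      (fun z => HahnSeries.single (1 : ℤ) 1 * z) (by intro u i; simp [coeff_single_mul']) P ?_ ?_
      A B ?_ ?_ ⟨HahnSeries.single B 1, fun i hi => by rw [HahnSeries.coeff_single_of_ne hi.ne], by simp⟩
    · intro a u hu
      have := hO _ (inO_C a) _ hu
      simpa [P] using this
    · intro u hu
      have := hO _ (inO_single zero_le_one (1 : k)) _ hu
      simpa [P] using this
    · intro u hu
      exact (hA _ hu).2.2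
    · intro u hu
      exact hB _ (by simp [cf_zero]) (by simp [cf_zero]) hu
  -- splitting off the slope zero line
  have hsplit : ∀ u s z, ((u, s, z) : Iso k) ∈ Λ → ((0, 0, z) : Iso k) ∈ Λ := by
    intro u s z hv
    have hit : ∀ N : ℕ, ∃ u' s' z', ((u', s', z') : Iso k) ∈ Λ ∧ (∀ i < A + N, cf u' i = 0) ∧
        (∀ i < A + N, cf s' i = 0) ∧ (∀ i, z'.coeff i = 0 ↔ z.coeff i = 0) := by
      intro N
      induction N with
      | zero => exact ⟨u, s, z, hv, by simpa using (hA _ hv).1, by simpa using (hA _ hv).2.1,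
          fun i => Iff.rfl⟩
      | succ N ih =>
        obtain ⟨u', s', z', h1, h2, h3, h4⟩ := ih
        refine ⟨_, _, _, hF _ h1, fun i hi => ?_, fun i hi => ?_, fun i => ?_⟩
        · rw [cf_ph' σ hσ]; simp only
          rw [h2 _ (by push_cast at hi; omega), zero_pow hq]
        · rw [cf_ph' σ hσ]; simp only
          rw [h3 _ (by push_cast at hi; omega), zero_pow hq]
        · rw [hσ, pow_eq_zero_iff hq]; exact h4 i
    obtain ⟨u', s', z', h1, h2, h3, h4⟩ := hit (B - A).toNat
    have h5 : ((u', s', 0) : Iso k) ∈ Λ := hB _ (fun i hi => h2 i (by omega))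
      (fun i hi => h3 i (by omega)) (by simp)
    have h6 : ((0, 0, z') : Iso k) ∈ Λ := by simpa using Λ.sub_mem h1 h5
    rw [ha] at h6 ⊢
    exact fun i hi => (h4 i).1 (h6 i hi)
  -- the kernel line
  have hcfφ : ∀ (u : LaurentSeries k × LaurentSeries k) i, cf (ph σ u) (i + 1) = 0 ↔ cf u i = 0 := by
    intro u i
    rw [cf_ph σ hσ, pow_eq_zero_iff hq]
  have hne : ∃ u : LaurentSeries k × LaurentSeries k, (∀ i < B, cf u i = 0) ∧ cf u B ≠ 0 :=
    ⟨pw B, fun i hi => by rw [cf_pw, if_neg hi.ne], by rw [cf_pw]; simp⟩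
  obtain ⟨m, hm⟩ : ∃ m : ℤ, ∀ s, ((0, s, 0) : Iso k) ∈ Λ ↔ ∀ i < m, cf s i = 0 := by
    let P : AddSubgroup (LaurentSeries k × LaurentSeries k) :=
      { carrier := {z | ((0, z, 0) : Iso k) ∈ Λ}
        zero_mem' := Λ.zero_mem
        add_mem' := fun {x y} hx hy => by simpa using Λ.add_mem hx hy
        neg_mem' := fun {x} hx => by simpa using Λ.neg_mem hx }
    refine lat cf cf_sub cf_C (ph σ) hcfφ P ?_ ?_ A B ?_ ?_ hne
    · intro a u hu
      have := hO _ (inO_C a) _ hu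
      simpa [P] using this
    · intro u hu
      have := hF _ hu
      simpa [P, Fr, ph_zero] using this
    · intro u hu
      exact (hA _ hu).2.1
    · intro u hu
      exact hB _ (by simp [cf_zero]) hu (by simp)
  -- the quotient line
  obtain ⟨n, hn⟩ : ∃ n : ℤ, ∀ u, (∃ s, ((u, s, 0) : Iso k) ∈ Λ) ↔ ∀ i < n, cf u i = 0 := by
    let P : AddSubgroup (LaurentSeries k × LaurentSeries k) :=
      { carrier := {u | ∃ s, ((u, s, 0) : Iso k) ∈ Λ}
        zero_mem' := ⟨0, Λ.zero_mem⟩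
        add_mem' := fun {x y} ⟨s, hx⟩ ⟨s', hy⟩ => ⟨s + s', by simpa using Λ.add_mem hx hy⟩
        neg_mem' := fun {x} ⟨s, hx⟩ => ⟨-s, by simpa using Λ.neg_mem hx⟩ }
    refine lat cf cf_sub cf_C (ph σ) hcfφ P ?_ ?_ A B ?_ ?_ hne
    · rintro a u ⟨s, hu⟩
      have := hO _ (inO_C a) _ hu
      exact ⟨_, by simpa using this⟩
    · rintro u ⟨s, hu⟩
      have := hF _ hu
      exact ⟨ph σ s, by simpa [Fr] using this⟩
    · rintro u ⟨s, hu⟩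
      exact (hA _ hu).1
    · intro u hu
      exact ⟨0, hB _ hu (by simp [cf_zero]) (by simp)⟩
  -- the generator
  obtain ⟨s0, hs0⟩ := (hn (pw n)).2 fun i hi => by rw [cf_pw, if_neg hi.ne]
  obtain ⟨s, hs⟩ : ∃ s : LaurentSeries k × LaurentSeries k,
      ∀ i, cf s i = if i < m then cf s0 i else 0 := by
    obtain ⟨C, hC⟩ := exists_bound_cf s0
    exact exists_cf _ C fun i hi => by rw [hC i hi, ite_self]
  have hw : ((pw n, s, 0) : Iso k) ∈ Λ := by
    have h1 : ((0, s0 - s, 0) : Iso k) ∈ Λ := by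
      rw [hm]
      intro i hi
      rw [cf_sub, hs, if_pos hi, sub_self]
    simpa using Λ.sub_mem hs0 h1
  -- the relation from Verschiebung
  have hfix : ∀ i < m - 1, cf s i ^ q ^ 2 = cf s i := by
    choose rt hrt using fun x : k => IsAlgClosed.exists_pow_nat_eq x (Nat.pos_of_ne_zero hq)
    obtain ⟨s', hs'⟩ : ∃ s' : LaurentSeries k × LaurentSeries k,
        ∀ i, cf s' i = rt (cf s (i - 1)) := by
      obtain ⟨C, hC⟩ := exists_bound_cf s
      refine exists_cf _ C fun i hi => ?_
      have := hrt (cf s (i - 1))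
      rw [hC (i - 1) (by omega)] at this ⊢
      exact (pow_eq_zero_iff hq).1 this
    have h1 : ((pw (n + 1), s', 0) : Iso k) ∈ Λ := by
      refine hV _ hw _ ?_
      ext1
      · refine cf_ext fun i => ?_
        simp only [Fr, Prod.smul_fst]
        rw [ph_pw σ hσ hq, cf_single, cf_pw, cf_pw, one_mul]
        have : i = n + 1 + 1 ↔ i - 2 * 1 = n := by omega
        simp only [this]
      ext1
      · refine cf_ext fun i => ?_
        simp only [Fr, Prod.smul_fst, Prod.smul_snd]
        rw [cf_ph' σ hσ, hs', hrt, cf_single, one_mul]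
        congr 1; ring
      · simp [Fr]
    have h2 : ((0, ph σ s - s', 0) : Iso k) ∈ Λ := by
      have := Λ.sub_mem (hF _ hw) h1
      simpa [Fr, ph_pw σ hσ hq] using this
    rw [hm] at h2
    intro i hi
    have h3 := h2 (i + 1) (by omega)
    rw [cf_sub, cf_ph σ hσ, hs', add_sub_cancel_right, sub_eq_zero] at h3
    rw [sq, pow_mul, h3, hrt]
  refine ⟨cf s (m - 1) ^ q ^ 2 - cf s (m - 1), ![(0, 0, HahnSeries.single a 1), (0, pw (m + 1), 0),
    (0, pw m, 0), Fr σ (pw n, s, 0), (pw n, s, 0)], ?_, ?_, ?_, ?_, ?_, ?_, ?_⟩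
  · intro j
    fin_cases j
    · exact (ha _).2 fun i hi => by rw [HahnSeries.coeff_single_of_ne hi.ne]
    · exact (hm _).2 fun i hi => by rw [cf_pw, if_neg (by omega)]
    · exact (hm _).2 fun i hi => by rw [cf_pw, if_neg (by omega)]
    · exact hF _ hw
    · exact hw
  · simp [Fr, ph_zero, sig_single σ hσ hq]
  · have : (pw (m + 1 + 1) : LaurentSeries k × LaurentSeries k) =
        (HahnSeries.single (1 : ℤ) 1 : LaurentSeries k) • pw m := by
      refine cf_ext fun i => ?_
      rw [cf_single, cf_pw, cf_pw, one_mul]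
      have : i = m + 1 + 1 ↔ i - 2 * 1 = m := by omega
      simp only [this]
    simp [Fr, ph_zero, ph_pw σ hσ hq, this]
  · simp [Fr, ph_zero, ph_pw σ hσ hq]
  · have h1 : (pw (n + 1 + 1) : LaurentSeries k × LaurentSeries k) =
        (HahnSeries.single (1 : ℤ) 1 : LaurentSeries k) • pw n := by
      refine cf_ext fun i => ?_
      rw [cf_single, cf_pw, cf_pw, one_mul]
      have : i = n + 1 + 1 ↔ i - 2 * 1 = n := by omega
      simp only [this]
    have h2 : ph σ (ph σ s) =
        (HahnSeries.C (cf s (m - 1) ^ q ^ 2 - cf s (m - 1)) : LaurentSeries k) • pw (m + 1) +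
        (HahnSeries.single (1 : ℤ) 1 : LaurentSeries k) • s := by
      refine cf_ext fun i => ?_
      rw [cf_add, cf_ph' σ hσ, cf_ph' σ hσ, cf_C, cf_single, cf_pw, one_mul, ← pow_mul, ← sq,
        show i - 1 - 1 = i - 2 * 1 by ring]
      rcases lt_trichotomy i (m + 1) with h | h | h
      · rw [hfix _ (by omega), if_neg (by omega)]; simp
      · subst h
        rw [show m + 1 - 2 * 1 = m - 1 by ring]; simp
      · rw [if_neg (by omega), hs, if_neg (by omega)]; simp [hq]
    simp only [Fr, Matrix.cons_val]
    rw [ph_pw σ hσ hq, ph_pw σ hσ hq, h1, h2]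
    simp
  · simp
  · rintro ⟨u, r, z⟩ hv
    have hz := hsplit _ _ _ hv
    have hv' : ((u, r, 0) : Iso k) ∈ Λ := by simpa using Λ.sub_mem hv hz
    rw [ha] at hz
    obtain ⟨c4, c3, h4, h3, hu⟩ := fil_span n u ((hn u).1 ⟨r, hv'⟩)
    have h5 : ((0, r - c4 • s - c3 • ph σ s, 0) : Iso k) ∈ Λ := by
      have := Λ.sub_mem (Λ.sub_mem hv' (hO c4 h4 _ hw)) (hO c3 h3 _ (hF _ hw))
      rw [hu] at this
      simpa [Fr, ph_pw σ hσ hq] using this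
    rw [hm] at h5
    obtain ⟨c2, c1, h2, h1, hr⟩ := fil_span m _ h5
    refine ⟨![HahnSeries.single (-a) 1 * z, c1, c2, c3, c4], ?_, ?_⟩
    · intro j
      fin_cases j
      · intro i hi
        change (HahnSeries.single (-a) 1 * z).coeff i = 0
        rw [coeff_single_mul', hz _ (by omega), mul_zero]
      · exact h1
      · exact h2
      · exact h3
      · exact h4
    · have hr' : r = c2 • pw m + c1 • pw (m + 1) + c3 • ph σ s + c4 • s := by
        rw [← hr]; abel
      have hz' : HahnSeries.single (-a) 1 * z * HahnSeries.single a 1 = z := by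
        rw [mul_right_comm, HahnSeries.single_mul_single]; simp
      rw [Fin.sum_univ_five]
      ext1
      · simp only [Fr, Matrix.cons_val, Prod.fst_add, Prod.smul_fst, ph_pw σ hσ hq]
        rw [hu]; simp [add_comm]
      ext1
      · simp only [Fr, Matrix.cons_val, Prod.fst_add, Prod.snd_add, Prod.smul_snd, Prod.smul_fst]
        rw [hr', smul_zero, zero_add, add_comm (c1 • _)]
      · simp [Fr, hz']


def toV (v : Iso k) : Fin 5 → LaurentSeries k := ![v.1.1, v.1.2, v.2.1.1, v.2.1.2, v.2.2]

lemma toV_add (v w : Iso k) : toV (v + w) = toV v + toV w := by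
  ext1 i; fin_cases i <;> simp [toV]
lemma toV_neg (v : Iso k) : toV (-v) = -toV v := by
  ext1 i; fin_cases i <;> simp [toV]
lemma toV_zero : toV (0 : Iso k) = 0 := by
  ext1 i; fin_cases i <;> simp [toV]
lemma toV_smul (x : LaurentSeries k) (v : Iso k) : toV (x • v) = x • toV v := by
  ext1 i; fin_cases i <;> simp [toV]
lemma toV_surj (y : Fin 5 → LaurentSeries k) : ∃ v : Iso k, toV v = y :=
  ⟨((y 0, y 1), (y 2, y 3), y 4), by ext1 i; fin_cases i <;> simp [toV]⟩

lemma toV_Fr (σ : LaurentSeries k →+* LaurentSeries k) (v : Iso k) :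
    toV (Fr σ v) = Matrix.mulVec
      (!![0, 1, 0, 0, 0;
          HahnSeries.single (1 : ℤ) 1, 0, 0, 0, 0;
          0, 0, 0, 1, 0;
          0, 0, HahnSeries.single (1 : ℤ) 1, 0, 0;
          0, 0, 0, 0, 1] : Matrix (Fin 5) (Fin 5) (LaurentSeries k)) (fun i => σ (toV v i)) := by
  ext1 i
  fin_cases i <;> simp [toV, Fr, ph, Matrix.mulVec, dotProduct, Fin.sum_univ_five]

lemma cf_bound_iff (u : LaurentSeries k × LaurentSeries k) (A : ℤ) (h1 : ∀ i < A, u.1.coeff i = 0)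
    (h2 : ∀ i < A, u.2.coeff i = 0) (i : ℤ) (hi : i < 2 * A) : cf u i = 0 := by
  rcases Int.even_or_odd' i with ⟨j, rfl | rfl⟩
  · rw [cf_even, h2 _ (by omega)]
  · rw [cf_odd, h1 _ (by omega)]

lemma inO_shift {x : LaurentSeries k} {A : ℤ} :
    InO (HahnSeries.single (-A) 1 * x) ↔ ∀ i < A, x.coeff i = 0 := by
  constructor
  · intro h i hi
    have := h (i - A) (by omega)
    rw [coeff_single_mul'] at this
    simpa using this
  · intro h m hm
    rw [coeff_single_mul', h _ (by omega), mul_zero]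

end S6
end

/-- The first representative lemma of Section 3.2: every `b ∈ Kε^μK`, `μ = (1,1,0,0,0)`,
that is `σ`-conjugate to `b₃` (slopes `(1/2,1/2,1/2,1/2,0)`) can be brought into the form
`x_t` by `K`-`σ`-conjugation. -/
theorem statement6 (p r q : ℕ) [Fact p.Prime] (hr : 0 < r) (hq : q = p ^ r)
    (k : Type*) [Field k] [Algebra (GaloisField p r) k] [IsAlgClosure (GaloisField p r) k]
    (σL : LaurentSeries k →+* LaurentSeries k)
    (hσL : ∀ (x : LaurentSeries k) (m : ℤ), (σL x).coeff m = x.coeff m ^ q)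
    (b : GL (Fin 5) (LaurentSeries k))
    -- `b ∈ K·ε^μ·K` with `ε^μ = diag(ε,ε,1,1,1)`
    (hbμ : ∃ u w : GL (Fin 5) (LaurentSeries k), InK u ∧ InK w ∧
      (b : Matrix (Fin 5) (Fin 5) (LaurentSeries k)) =
        (u : Matrix (Fin 5) (Fin 5) (LaurentSeries k)) *
        Matrix.diagonal ![HahnSeries.single (1 : ℤ) 1, HahnSeries.single (1 : ℤ) 1, 1, 1, 1] *
        (w : Matrix (Fin 5) (Fin 5) (LaurentSeries k)))
    -- `b` is `σ`-conjugate in `GL₅(L)` to `b₃`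
    (hbσ : ∃ h : GL (Fin 5) (LaurentSeries k),
      ((h⁻¹ : GL (Fin 5) (LaurentSeries k)) : Matrix (Fin 5) (Fin 5) (LaurentSeries k)) *
        (b : Matrix (Fin 5) (Fin 5) (LaurentSeries k)) *
        (RingHom.mapMatrix σL) (h : Matrix (Fin 5) (Fin 5) (LaurentSeries k)) =
      (!![0, 1, 0, 0, 0;
          HahnSeries.single (1 : ℤ) 1, 0, 0, 0, 0;
          0, 0, 0, 1, 0;
          0, 0, HahnSeries.single (1 : ℤ) 1, 0, 0;
          0, 0, 0, 0, 1] : Matrix (Fin 5) (Fin 5) (LaurentSeries k))) :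
    ∃ t : k, ∃ g : GL (Fin 5) (LaurentSeries k), InK g ∧
      ((g⁻¹ : GL (Fin 5) (LaurentSeries k)) : Matrix (Fin 5) (Fin 5) (LaurentSeries k)) *
        (b : Matrix (Fin 5) (Fin 5) (LaurentSeries k)) *
        (RingHom.mapMatrix σL) (g : Matrix (Fin 5) (Fin 5) (LaurentSeries k)) =
      (!![1, 0, 0, 0, 0;
          0, 0, 1, HahnSeries.C t, 0;
          0, HahnSeries.single (1 : ℤ) 1, 0, 0, 0;
          0, 0, 0, 0, 1;
          0, 0, 0, HahnSeries.single (1 : ℤ) 1, 0] :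
        Matrix (Fin 5) (Fin 5) (LaurentSeries k)) := by
  classical
  have hq0 : q ≠ 0 := by
    rw [hq]; exact pow_ne_zero _ (Fact.out : p.Prime).ne_zero
  have : IsAlgClosed k := IsAlgClosure.isAlgClosed (GaloisField p r)
  obtain ⟨u, w, hu, hw, hb⟩ := hbμ
  obtain ⟨h, hh⟩ := hbσ
  set b3 : Matrix (Fin 5) (Fin 5) (LaurentSeries k) := !![0, 1, 0, 0, 0;
          HahnSeries.single (1 : ℤ) 1, 0, 0, 0, 0;
          0, 0, 0, 1, 0;
          0, 0, HahnSeries.single (1 : ℤ) 1, 0, 0;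
          0, 0, 0, 0, 1] with hb3
  set H : Matrix (Fin 5) (Fin 5) (LaurentSeries k) := h.val with hH
  set H' : Matrix (Fin 5) (Fin 5) (LaurentSeries k) :=
    (h⁻¹ : GL (Fin 5) (LaurentSeries k)).val with hH'
  have hHH' : H * H' = 1 := by rw [hH, hH', ← Units.val_mul, mul_inv_cancel, Units.val_one]
  have hH'H : H' * H = 1 := by rw [hH, hH', ← Units.val_mul, inv_mul_cancel, Units.val_one]
  have hcomm : H * b3 = b.val * (RingHom.mapMatrix σL) H := by
    rw [← hh, ← mul_assoc, ← mul_assoc, hHH', one_mul]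
  have hσmv : ∀ (M : Matrix (Fin 5) (Fin 5) (LaurentSeries k)) (y : Fin 5 → LaurentSeries k),
      ((RingHom.mapMatrix σL) M).mulVec (fun i => σL (y i)) = fun i => σL (M.mulVec y i) := by
    intro M y
    ext1 i
    simp [Matrix.mulVec, dotProduct, map_sum]
  have hFH : ∀ v : S6.Iso k, H.mulVec (S6.toV (S6.Fr σL v)) =
      b.val.mulVec (fun i => σL (H.mulVec (S6.toV v) i)) := by
    intro v
    rw [S6.toV_Fr, Matrix.mulVec_mulVec, ← hb3, hcomm, ← Matrix.mulVec_mulVec, hσmv]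
  have hσO : ∀ x, InO (σL x) ↔ InO x := by
    intro x
    simp only [InO, hσL, pow_eq_zero_iff hq0]
  have hDint : ∀ i j, InO ((Matrix.diagonal ![HahnSeries.single (1 : ℤ) 1,
      HahnSeries.single (1 : ℤ) 1, 1, 1, 1] : Matrix (Fin 5) (Fin 5) (LaurentSeries k)) i j) := by
    have h1 : InO (1 : LaurentSeries k) := by simpa using S6.inO_C (1 : k)
    have h2 := S6.inO_single zero_le_one (1 : k)
    intro i j
    rw [Matrix.diagonal_apply]
    split_ifs
    · fin_cases i
      exacts [h2, h2, h1, h1, h1]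
    · exact S6.inO_zero
  let Λ : AddSubgroup (S6.Iso k) :=
    { carrier := {v | ∀ i, InO (H.mulVec (S6.toV v) i)}
      zero_mem' := fun i => by
        rw [S6.toV_zero, Matrix.mulVec_zero]; exact S6.inO_zero
      add_mem' := fun {x y} hx hy i => by
        rw [S6.toV_add, Matrix.mulVec_add]; exact S6.InO.add (hx i) (hy i)
      neg_mem' := fun {x} hx i => by
        rw [S6.toV_neg, Matrix.mulVec_neg]; exact S6.InO.neg (hx i) }
  have hmem : ∀ v, v ∈ Λ ↔ ∀ i, InO (H.mulVec (S6.toV v) i) := fun v => Iff.rfl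
  obtain ⟨A, hA⟩ := S6.exists_bound_mat H'
  obtain ⟨B, hB⟩ := S6.exists_bound_mat H
  have hA' : ∀ v ∈ Λ, ∀ j, ∀ i < A, (S6.toV v j).coeff i = 0 := by
    intro v hv j
    rw [← S6.inO_shift]
    have h1 : S6.toV v = H'.mulVec (H.mulVec (S6.toV v)) := by
      rw [Matrix.mulVec_mulVec, hH'H, Matrix.one_mulVec]
    have h2 := S6.InO.mulVec (M := (HahnSeries.single (-A) 1 : LaurentSeries k) • H')
      (fun i j => by simpa using hA i j) hv j
    rw [Matrix.smul_mulVec, ← h1] at h2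
    simpa using h2
  have hB' : ∀ v, (∀ j, ∀ i < -B, (S6.toV v j).coeff i = 0) → v ∈ Λ := by
    intro v hv
    rw [hmem]
    intro i
    have h2 := S6.InO.mulVec (M := (HahnSeries.single (-B) 1 : LaurentSeries k) • H)
      (v := (HahnSeries.single B 1 : LaurentSeries k) • S6.toV v)
      (fun i j => by simpa using hB i j)
      (fun j => by
        have := S6.inO_shift.2 (hv j)
        rw [neg_neg] at this
        simpa using this) i
    rw [Matrix.smul_mulVec, Matrix.mulVec_smul, smul_smul, HahnSeries.single_mul_single] at h2
    simpa using h2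
  obtain ⟨t, e, he, e0, e1, e2, e3, e4, hspan⟩ := S6.main_lat σL hσL hq0 Λ
    (by
      intro x hx v hv i
      rw [S6.toV_smul, Matrix.mulVec_smul]
      exact S6.InO.mul hx (hv i))
    (by
      intro v hv
      rw [hmem, hFH, hb]
      refine S6.InO.mulVec (fun i j => ?_) fun i => (hσO _).2 (hv i)
      rw [Matrix.mul_apply]
      simp only [Matrix.mul_apply]
      refine S6.InO.sum _ _ fun l _ => S6.InO.mul (S6.InO.sum _ _ fun l' _ =>
        S6.InO.mul (hu.1 _ _) (hDint _ _)) (hw.1 _ _))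
    (by
      intro v hv v' hv'
      rw [hmem]
      intro i
      rw [← hσO]
      have h1 := hFH v'
      rw [hv', S6.toV_smul, Matrix.mulVec_smul] at h1
      set y : Fin 5 → LaurentSeries k := fun i => σL (H.mulVec (S6.toV v') i) with hy
      have h2 := congrArg ((u⁻¹ : GL (Fin 5) (LaurentSeries k)).val.mulVec) h1
      rw [Matrix.mulVec_smul, hb, Matrix.mulVec_mulVec y, ← mul_assoc, ← mul_assoc, ← Units.val_mul,
        inv_mul_cancel, Units.val_one, one_mul, ← Matrix.mulVec_mulVec y _ w.val] at h2
      have h3 := S6.InO.mulVec hu.2 hv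
      set z := ((u⁻¹ : GL (Fin 5) (LaurentSeries k)).val.mulVec
        (H.mulVec (S6.toV v))) with hz
      have h4 : ∀ i, InO ((w.val.mulVec y) i) := by
        intro i
        have h5 := congrFun h2 i
        rw [Matrix.mulVec_diagonal] at h5
        have hε : (HahnSeries.single (1 : ℤ) 1 : LaurentSeries k) ≠ 0 := by simp
        have h6 : InO ((HahnSeries.single (1 : ℤ) 1 : LaurentSeries k) * z i) :=
          S6.InO.mul (S6.inO_single zero_le_one 1) (h3 i)
        have hl : (HahnSeries.single (1 : ℤ) 1 : LaurentSeries k) * z i =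
            HahnSeries.single (1 : ℤ) 1 * (w.val.mulVec y) i →
            InO ((w.val.mulVec y) i) := by
          intro h7
          rw [← mul_left_cancel₀ hε h7]; exact h3 i
        have hr : (HahnSeries.single (1 : ℤ) 1 : LaurentSeries k) * z i =
            1 * (w.val.mulVec y) i →
            InO ((w.val.mulVec y) i) := by
          intro h7
          rw [one_mul] at h7
          rw [← h7]; exact h6
        fin_cases i
        exacts [hl h5, hl h5, hr h5, hr h5, hr h5]
      have h5 := S6.InO.mulVec hw.2 h4 i
      rwa [Matrix.mulVec_mulVec, ← Units.val_mul, inv_mul_cancel, Units.val_one,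
        Matrix.one_mulVec] at h5)
    (min A (2 * A)) (max (-B) (2 * (-B)))
    (by
      intro v hv
      have h1 := hA' v hv
      refine ⟨fun i hi => S6.cf_bound_iff _ A (h1 0) (h1 1) i (by omega),
        fun i hi => S6.cf_bound_iff _ A (h1 2) (h1 3) i (by omega),
        fun i hi => h1 4 i (by omega)⟩)
    (by
      intro v h1 h2 h3
      refine hB' v fun j i hi => ?_
      fin_cases j
      · change v.1.1.coeff i = 0
        rw [← S6.cf_odd]; exact h1 _ (by omega)
      · change v.1.2.coeff i = 0
        rw [← S6.cf_even]; exact h1 _ (by omega)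
      · change v.2.1.1.coeff i = 0
        rw [← S6.cf_odd]; exact h2 _ (by omega)
      · change v.2.1.2.coeff i = 0
        rw [← S6.cf_even]; exact h2 _ (by omega)
      · exact h3 _ (by omega))
  -- the change of basis matrix
  let E : Matrix (Fin 5) (Fin 5) (LaurentSeries k) := Matrix.of fun i j => S6.toV (e j) i
  have hC : ∀ l : Fin 5, ∃ c : Fin 5 → LaurentSeries k, (∀ j, InO (c j)) ∧
      ∀ i, H' i l = ∑ j, E i j * c j := by
    intro l
    obtain ⟨v, hv⟩ := S6.toV_surj (fun i => H' i l)
    have hvΛ : v ∈ Λ := by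
      rw [hmem, hv]
      intro i
      have : H.mulVec (fun i => H' i l) i = (H * H') i l := rfl
      rw [this, hHH', Matrix.one_apply]
      split_ifs
      · simpa using S6.inO_C (1 : k)
      · exact S6.inO_zero
    obtain ⟨c, hc, hvc⟩ := hspan v hvΛ
    refine ⟨c, hc, fun i => ?_⟩
    have h1 := congrFun hv i
    rw [hvc] at h1
    refine h1.symm.trans ?_
    simp only [Fin.sum_univ_five, S6.toV_add, S6.toV_smul, Pi.add_apply, Pi.smul_apply, smul_eq_mul,
      E, Matrix.of_apply]
    ring
  choose c hc hcE using hC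
  let Cm : Matrix (Fin 5) (Fin 5) (LaurentSeries k) := Matrix.of fun j l => c l j
  have hEC : E * Cm = H' := by
    ext1 i l
    rw [hcE l i, Matrix.mul_apply]
    rfl
  have hgC : (H * E) * Cm = 1 := by rw [mul_assoc, hEC, hHH']
  let g : GL (Fin 5) (LaurentSeries k) := ⟨H * E, Cm, hgC, mul_eq_one_comm.1 hgC⟩
  have hCE : Cm * H * E = 1 := by rw [mul_assoc]; exact mul_eq_one_comm.1 hgC
  have hbE : b3 * (RingHom.mapMatrix σL) E = E * !![1, 0, 0, 0, 0;
          0, 0, 1, HahnSeries.C t, 0;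
          0, HahnSeries.single (1 : ℤ) 1, 0, 0, 0;
          0, 0, 0, 0, 1;
          0, 0, 0, HahnSeries.single (1 : ℤ) 1, 0] := by
    ext1 i j
    have h1 : (b3 * (RingHom.mapMatrix σL) E) i j = S6.toV (S6.Fr σL (e j)) i := by
      rw [S6.toV_Fr]; rfl
    rw [h1, Matrix.mul_apply, Fin.sum_univ_five]
    fin_cases j
    · change S6.toV (S6.Fr σL (e 0)) i = _
      rw [e0]; simp [E]
    · change S6.toV (S6.Fr σL (e 1)) i = _
      rw [e1, S6.toV_smul]; simp [E, mul_comm]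
    · change S6.toV (S6.Fr σL (e 2)) i = _
      rw [e2]; simp [E]
    · change S6.toV (S6.Fr σL (e 3)) i = _
      rw [e3, S6.toV_add, S6.toV_smul, S6.toV_smul]; simp [E, mul_comm]
    · change S6.toV (S6.Fr σL (e 4)) i = _
      rw [e4]; simp [E]
  refine ⟨t, g, ⟨fun i j => ?_, fun i j => hc j i⟩, ?_⟩
  · exact he j i
  · change Cm * b.val * (RingHom.mapMatrix σL) (H * E) = _
    rw [map_mul, mul_assoc, ← mul_assoc b.val, ← hcomm, mul_assoc, hbE, ← mul_assoc,
      ← mul_assoc, hCE, one_mul]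
end
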